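/- There exist hsops of I_8 (the ring of invariants of the binary octavic) with each of the following 13 degree sequences: (2,3,4,5,6,7), (2,3,4,5,8,42), (2,3,4,5,9,42), (2,3,4,5,10,42), (2,3,4,6,8,35), (2,3,4,6,9,35), (2,3,4,7,8,30), (2,3,4,7,9,30), (2,3,4,8,9,210), (2,3,5,6,9,28), (2,3,5,6,10,28), (2,3,5,9,12,14), and (2,4,5,6,8,21). -/

import Mathlib

set_option synthInstance.maxHeartbeats 1000000
noncomputable section

open MvPolynomial

/-- The binary form of degree `n` with coefficient vector `a`, as a polynomial in two
variables `X 0 = x`, `X 1 = y`. -/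
def formPoly (n : ℕ) (a : Fin (n+1) → ℂ) : MvPolynomial (Fin 2) ℂ :=
  ∑ i : Fin (n+1), C (a i) * X 0 ^ (n - (i : ℕ)) * X 1 ^ (i : ℕ)

/-- The action of `SL(2,ℂ)` on coefficient vectors of binary forms of degree `n`,
given by linear substitution of the variables `x`, `y`. -/
def sl2Act (n : ℕ) (g : Matrix.SpecialLinearGroup (Fin 2) ℂ) (a : Fin (n+1) → ℂ) :
    Fin (n+1) → ℂ := fun i =>
  coeff (Finsupp.single 0 (n - (i : ℕ)) + Finsupp.single 1 (i : ℕ))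
    (bind₁ (fun j : Fin 2 => C (g.1 j 0) * X 0 + C (g.1 j 1) * X 1) (formPoly n a))

/-- The ring of invariants `I_n` of the binary form of degree `n`: the subalgebra of
`ℂ[a_0,…,a_n]` of polynomials invariant under the `SL(2,ℂ)`-action. -/
def invariantRing (n : ℕ) : Subalgebra ℂ (MvPolynomial (Fin (n+1)) ℂ) where
  carrier := {p | ∀ g : Matrix.SpecialLinearGroup (Fin 2) ℂ, ∀ a : Fin (n+1) → ℂ,
    eval (sl2Act n g a) p = eval a p}
  mul_mem' := by
    intro p q hp hq g a
    simp only [Set.mem_setOf_eq, map_mul] at *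
    rw [hp g a, hq g a]
  add_mem' := by
    intro p q hp hq g a
    simp only [Set.mem_setOf_eq, map_add] at *
    rw [hp g a, hq g a]
  algebraMap_mem' := by
    intro c g a
    simp

/-- `IsHSOP n d p` says that `p` is a homogeneous system of parameters of the invariant
ring of the binary form of degree `n`, with degree sequence `d` : the `p k` are
homogeneous of positive degrees `d k`, algebraically independent over `ℂ`, and `I_n` is a
finitely generated module over the subalgebra they generate. -/
def IsHSOP (n : ℕ) (d : Fin (n-2) → ℕ) (p : Fin (n-2) → invariantRing n) : Prop :=
  (∀ k, 0 < d k) ∧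
  (∀ k, ((p k : MvPolynomial (Fin (n+1)) ℂ)).IsHomogeneous (d k)) ∧
  AlgebraicIndependent ℂ p ∧
  Module.Finite (Algebra.adjoin ℂ (Set.range p)) (invariantRing n)

/-- The coefficient vector of `f(x + t y, y)` in terms of the coefficient vector of an octavic `f`. -/
def shiftCoeff {R : Type*} [CommRing R] (t : R) (a : Fin 9 → R) : Fin 9 → R :=
  ![a 0,
    8 * t * a 0 + a 1,
    28 * t ^ 2 * a 0 + 7 * t * a 1 + a 2,
    56 * t ^ 3 * a 0 + 21 * t ^ 2 * a 1 + 6 * t * a 2 + a 3,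
    70 * t ^ 4 * a 0 + 35 * t ^ 3 * a 1 + 15 * t ^ 2 * a 2 + 5 * t * a 3 + a 4,
    56 * t ^ 5 * a 0 + 35 * t ^ 4 * a 1 + 20 * t ^ 3 * a 2 + 10 * t ^ 2 * a 3 + 4 * t * a 4 + a 5,
    28 * t ^ 6 * a 0 + 21 * t ^ 5 * a 1 + 15 * t ^ 4 * a 2 + 10 * t ^ 3 * a 3 + 6 * t ^ 2 * a 4 + 3 * t * a 5 + a 6,
    8 * t ^ 7 * a 0 + 7 * t ^ 6 * a 1 + 6 * t ^ 5 * a 2 + 5 * t ^ 4 * a 3 + 4 * t ^ 3 * a 4 + 3 * t ^ 2 * a 5 + 2 * t * a 6 + a 7,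
    t ^ 8 * a 0 + t ^ 7 * a 1 + t ^ 6 * a 2 + t ^ 5 * a 3 + t ^ 4 * a 4 + t ^ 3 * a 5 + t ^ 2 * a 6 + t * a 7 + a 8]

/-- Reversal of a coefficient vector, i.e. exchange of the two variables. -/
def revCoeff {R : Type*} (a : Fin 9 → R) : Fin 9 → R := fun i => a i.rev

theorem map_shiftCoeff {R S : Type*} [CommRing R] [CommRing S] (φ : R →+* S) (t : R)
    (a : Fin 9 → R) (i : Fin 9) :
    φ (shiftCoeff t a i) = shiftCoeff (φ t) (fun j => φ (a j)) i := by
  fin_cases i <;> simp [shiftCoeff, map_ofNat]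

theorem shiftCoeff_zero {R : Type*} [CommRing R] (a : Fin 9 → R) : shiftCoeff 0 a = a := by
  funext i
  fin_cases i <;> simp [shiftCoeff]

/-- The derivation on polynomial functions of octavics given by the infinitesimal substitution
`x ↦ x + t y`. -/
def raiseD : Derivation ℂ (MvPolynomial (Fin 9) ℂ) (MvPolynomial (Fin 9) ℂ) :=
  mkDerivation ℂ ![0, 8 * X 0, 7 * X 1, 6 * X 2, 5 * X 3, 4 * X 4, 3 * X 5, 2 * X 6, X 7]

/-- The derivation obtained from `raiseD` by exchanging the two variables. -/
def lowerD : Derivation ℂ (MvPolynomial (Fin 9) ℂ) (MvPolynomial (Fin 9) ℂ) :=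
  mkDerivation ℂ ![X 1, 2 * X 2, 3 * X 3, 4 * X 4, 5 * X 5, 6 * X 6, 7 * X 7, 8 * X 8, 0]

/-- The weight derivation. -/
def weightD : Derivation ℂ (MvPolynomial (Fin 9) ℂ) (MvPolynomial (Fin 9) ℂ) :=
  mkDerivation ℂ ![8 * X 0, 6 * X 1, 4 * X 2, 2 * X 3, 0, -2 * X 5, -4 * X 6, -6 * X 7, -8 * X 8]

theorem lie_raiseD_lowerD : ⁅raiseD, lowerD⁆ = weightD := by
  apply derivation_ext
  intro i
  have h (n : ℕ) [n.AtLeastTwo] (D : Derivation ℂ (MvPolynomial (Fin 9) ℂ) (MvPolynomial (Fin 9) ℂ)) :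
    D (OfNat.ofNat n) = 0 := D.map_natCast n
  fin_cases i <;> simp [Derivation.commutator_apply, raiseD, lowerD, weightD, mkDerivation_X, h] <;> ring

/-- The substitution of the generic shift into a polynomial function of octavics. -/
def shiftHom : MvPolynomial (Fin 9) ℂ →ₐ[ℂ] Polynomial (MvPolynomial (Fin 9) ℂ) :=
  aeval (shiftCoeff Polynomial.X fun i => Polynomial.C (X i))

theorem derivative_shiftHom (p : MvPolynomial (Fin 9) ℂ) :
    Polynomial.derivative (shiftHom p) = shiftHom (raiseD p) := by
  induction p using MvPolynomial.induction_on with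
  | C c => 
    simp only [derivation_C, map_zero]
    rw [shiftHom, ← MvPolynomial.algebraMap_eq, AlgHom.commutes]
    exact Polynomial.derivative_C
  | add p q hp hq => simp [hp, hq]
  | mul_X p i hp =>
    simp only [map_mul, Polynomial.derivative_mul, hp, Derivation.leibniz, smul_eq_mul, map_add]
    have h : Polynomial.derivative (shiftHom (X i)) = shiftHom (raiseD (X i)) := by
      simp only [raiseD, mkDerivation_X, shiftHom, aeval_X]
      have hC (n : ℕ) [n.AtLeastTwo] : Polynomial.C (OfNat.ofNat n : MvPolynomial (Fin 9) ℂ) = OfNat.ofNat n := map_ofNat _ n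
      fin_cases i <;> simp [shiftCoeff, Polynomial.derivative_mul, hC] <;> ring
    rw [h]
    ring

theorem eval_shiftHom (p : MvPolynomial (Fin 9) ℂ) (t : ℂ) (a : Fin 9 → ℂ) :
    Polynomial.eval t ((shiftHom p).map (eval a)) = eval (shiftCoeff t a) p := by
  induction p using MvPolynomial.induction_on with
  | C c => 
    rw [shiftHom, ← MvPolynomial.algebraMap_eq, AlgHom.commutes]
    simp [Polynomial.algebraMap_eq, IsScalarTower.algebraMap_apply ℂ (MvPolynomial (Fin 9) ℂ) (Polynomial (MvPolynomial (Fin 9) ℂ))]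
  | add p q hp hq => simp [hp, hq]
  | mul_X p i hp =>
    simp only [map_mul, Polynomial.map_mul, Polynomial.eval_mul, hp, eval_X]
    congr 1
    rw [shiftHom, aeval_X]
    have := map_shiftCoeff ((Polynomial.evalRingHom t).comp (Polynomial.mapRingHom (eval a))) Polynomial.X (fun i => Polynomial.C (X i)) i
    simpa using this

theorem shiftHom_coeff_zero (p : MvPolynomial (Fin 9) ℂ) : (shiftHom p).coeff 0 = p := by
  apply MvPolynomial.funext
  intro a
  have := eval_shiftHom p 0 a
  rw [shiftCoeff_zero, ← Polynomial.coeff_zero_eq_eval_zero, Polynomial.coeff_map] at this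
  exact this

theorem raiseD_eq_zero_iff (p : MvPolynomial (Fin 9) ℂ) :
    raiseD p = 0 ↔ ∀ (t : ℂ) (a : Fin 9 → ℂ), eval (shiftCoeff t a) p = eval a p := by
  constructor
  · intro h t a
    have h1 : Polynomial.derivative (shiftHom p) = 0 := by rw [derivative_shiftHom, h, map_zero]
    have h2 := Polynomial.eq_C_of_derivative_eq_zero h1
    rw [shiftHom_coeff_zero] at h2
    rw [← eval_shiftHom, h2]
    simp
  · intro h
    apply MvPolynomial.funext
    intro a
    have h1 : (shiftHom p).map (eval a) = Polynomial.C (eval a p) := by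
      apply Polynomial.funext
      intro t
      rw [eval_shiftHom, h, Polynomial.eval_C]
    rw [← shiftHom_coeff_zero (raiseD p), ← derivative_shiftHom, ← Polynomial.coeff_map,
      ← Polynomial.derivative_map, h1]
    simp

theorem raiseD_iterate_eq_zero (p : MvPolynomial (Fin 9) ℂ) : ∃ n, ∀ k ≥ n, raiseD^[k] p = 0 := by
  refine ⟨(shiftHom p).natDegree + 1, fun k hk => ?_⟩
  have h : ∀ k, Polynomial.derivative^[k] (shiftHom p) = shiftHom (raiseD^[k] p) := by
    intro k
    induction k with
    | zero => rfl
    | succ k ih => rw [Function.iterate_succ_apply', ih, derivative_shiftHom, Function.iterate_succ_apply']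
  rw [← shiftHom_coeff_zero (raiseD^[k] p), ← h, Polynomial.iterate_derivative_eq_zero (by omega)]
  simp

/-- Exchange of the two variables on polynomial functions of octavics. -/
def revHom : MvPolynomial (Fin 9) ℂ →ₐ[ℂ] MvPolynomial (Fin 9) ℂ := rename Fin.rev

theorem revHom_revHom (p : MvPolynomial (Fin 9) ℂ) : revHom (revHom p) = p := by
  rw [revHom, rename_rename, show Fin.rev ∘ Fin.rev = (id : Fin 9 → Fin 9) from funext Fin.rev_rev]
  exact rename_id_apply p

theorem raiseD_revHom (p : MvPolynomial (Fin 9) ℂ) : raiseD (revHom p) = revHom (lowerD p) := by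
  induction p using MvPolynomial.induction_on with
  | C c => simp [revHom, derivation_C]
  | add p q hp hq => simp [hp, hq]
  | mul_X p i hp =>
    simp only [map_mul, hp, Derivation.leibniz, smul_eq_mul, map_add]
    have h : raiseD (revHom (X i)) = revHom (lowerD (X i)) := by
      simp only [raiseD, lowerD, mkDerivation_X, revHom, rename_X]
      have h (n : ℕ) [n.AtLeastTwo] : (rename Fin.rev : MvPolynomial (Fin 9) ℂ →ₐ[ℂ] MvPolynomial (Fin 9) ℂ) (OfNat.ofNat n) = OfNat.ofNat n := map_ofNat _ n
      fin_cases i <;> simp [h, Fin.rev] 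
    rw [h]

theorem eval_revHom (a : Fin 9 → ℂ) (p : MvPolynomial (Fin 9) ℂ) : eval a (revHom p) = eval (revCoeff a) p := by
  rw [revHom, eval_rename]; rfl

theorem lowerD_eq_zero_iff (p : MvPolynomial (Fin 9) ℂ) :
    lowerD p = 0 ↔ ∀ (t : ℂ) (a : Fin 9 → ℂ),
      eval (revCoeff (shiftCoeff t (revCoeff a))) p = eval a p := by
  have h : lowerD p = 0 ↔ raiseD (revHom p) = 0 := by
    rw [raiseD_revHom]
    constructor
    · intro h; rw [h, map_zero]
    · intro h; rw [← revHom_revHom (lowerD p), h, map_zero]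
  have hr (a : Fin 9 → ℂ) : revCoeff (revCoeff a) = a := by
    funext i; simp [revCoeff]
  rw [h, raiseD_eq_zero_iff]
  simp only [eval_revHom]
  constructor
  · intro h t a
    rw [h, hr]
  · intro h t a
    have := h t (revCoeff a)
    rwa [hr] at this

theorem lowerD_iterate_eq_zero (p : MvPolynomial (Fin 9) ℂ) : ∃ n, ∀ k ≥ n, lowerD^[k] p = 0 := by
  obtain ⟨n, hn⟩ := raiseD_iterate_eq_zero (revHom p)
  refine ⟨n, fun k hk => ?_⟩
  have h : ∀ k, raiseD^[k] (revHom p) = revHom (lowerD^[k] p) := by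
    intro k
    induction k with
    | zero => rfl
    | succ k ih => rw [Function.iterate_succ_apply', ih, raiseD_revHom, Function.iterate_succ_apply']
  rw [← revHom_revHom (lowerD^[k] p), ← h, hn k hk, map_zero]

theorem coeff_formPoly (a : Fin (8 + 1) → ℂ) (i : Fin (8 + 1)) :
    coeff (Finsupp.single 0 (8 - (i : ℕ)) + Finsupp.single 1 (i : ℕ)) (formPoly 8 a) = a i := by
  have h (j : Fin (8 + 1)) : C (a j) * X 0 ^ (8 - (j : ℕ)) * X 1 ^ (j : ℕ)
      = monomial (Finsupp.single (0 : Fin 2) (8 - (j : ℕ)) + Finsupp.single 1 (j : ℕ)) (a j) := by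
    rw [X_pow_eq_monomial, X_pow_eq_monomial, C_mul_monomial, monomial_mul]
    simp
  simp only [formPoly, h, coeff_sum, coeff_monomial]
  rw [Finset.sum_eq_single i]
  · simp
  · intro j _ hj
    rw [if_neg]
    intro hh
    have := DFunLike.congr_fun hh 1
    simp at this
    exact hj (Fin.ext this)
  · simp

/-- The substitution `x ↦ p x + q y`, `y ↦ r x + s y`. -/
def linSubst (p q r s : ℂ) : MvPolynomial (Fin 2) ℂ →ₐ[ℂ] MvPolynomial (Fin 2) ℂ :=
  aeval ![C p * X 0 + C q * X 1, C r * X 0 + C s * X 1]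

theorem linSubst_C (p q r s c : ℂ) : linSubst p q r s (C c) = C c :=
  (linSubst p q r s).commutes c

theorem linSubst_X_zero (p q r s : ℂ) : linSubst p q r s (X 0) = C p * X 0 + C q * X 1 := by
  simp [linSubst]

theorem linSubst_X_one (p q r s : ℂ) : linSubst p q r s (X 1) = C r * X 0 + C s * X 1 := by
  simp [linSubst]

theorem linSubst_comp (p q r s p' q' r' s' : ℂ) :
    (linSubst p q r s).comp (linSubst p' q' r' s') =
      linSubst (p' * p + q' * r) (p' * q + q' * s) (r' * p + s' * r) (r' * q + s' * s) := by
  apply MvPolynomial.algHom_ext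
  rw [Fin.forall_fin_two]
  constructor
  · simp only [AlgHom.comp_apply, linSubst_X_zero, linSubst_X_one, map_add, map_mul, linSubst_C]
    ring
  · simp only [AlgHom.comp_apply, linSubst_X_zero, linSubst_X_one, map_add, map_mul, linSubst_C]
    ring

theorem bind₁_eq_rename_linSubst (p q r s : ℂ) (f : MvPolynomial (Fin 2) ℂ) :
    bind₁ (fun j : Fin 2 => C (![![p, q], ![r, s]] j 0) * X (0 : ℕ)
        + C (![![p, q], ![r, s]] j 1) * X (1 : ℕ)) f
      = rename Fin.val (linSubst p q r s f) := by
  have h : bind₁ (fun j : Fin 2 => C (![![p, q], ![r, s]] j 0) * X (0 : ℕ)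
        + C (![![p, q], ![r, s]] j 1) * X (1 : ℕ)) = (rename Fin.val).comp (linSubst p q r s) := by
    apply MvPolynomial.algHom_ext
    rw [Fin.forall_fin_two]
    constructor
    · simp [linSubst_X_zero]
    · simp [linSubst_X_one]
  exact DFunLike.congr_fun h f

theorem sl2Act_eq_of_linSubst (g : Matrix.SpecialLinearGroup (Fin 2) ℂ) (a b : Fin (8 + 1) → ℂ)
    (h : linSubst (g.1 0 0) (g.1 0 1) (g.1 1 0) (g.1 1 1) (formPoly 8 a) = formPoly 8 b) :
    sl2Act 8 g a = b := by
  funext i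
  have h1 := bind₁_eq_rename_linSubst (g.1 0 0) (g.1 0 1) (g.1 1 0) (g.1 1 1) (formPoly 8 a)
  rw [h] at h1
  have h2 : (fun j : Fin 2 => C (![![g.1 0 0, g.1 0 1], ![g.1 1 0, g.1 1 1]] j 0) * X (0 : ℕ)
      + C (![![g.1 0 0, g.1 0 1], ![g.1 1 0, g.1 1 1]] j 1) * X (1 : ℕ)) =
      fun j : Fin 2 => C (g.1 j 0) * X (0 : ℕ) + C (g.1 j 1) * X (1 : ℕ) := by
    funext j
    fin_cases j <;> rfl
  rw [h2] at h1
  have h3 : (Finsupp.single 0 (8 - (i : ℕ)) + Finsupp.single 1 (i : ℕ) : ℕ →₀ ℕ) =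
      (Finsupp.single (0 : Fin 2) (8 - (i : ℕ)) + Finsupp.single 1 (i : ℕ)).mapDomain Fin.val := by
    rw [Finsupp.mapDomain_add, Finsupp.mapDomain_single, Finsupp.mapDomain_single]
    rfl
  rw [← coeff_formPoly b i, ← coeff_rename_mapDomain Fin.val Fin.val_injective, ← h1, ← h3]
  rfl

theorem linSubst_shift (t : ℂ) (a : Fin 9 → ℂ) :
    linSubst 1 t 0 1 (formPoly 8 a) = formPoly 8 (shiftCoeff t a) := by
  have hn (n : ℕ) [n.AtLeastTwo] : (C (OfNat.ofNat n) : MvPolynomial (Fin 2) ℂ) = OfNat.ofNat n :=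
    map_ofNat _ n
  simp only [formPoly, map_sum, map_mul, map_pow, linSubst_C, linSubst_X_zero, linSubst_X_one]
  simp [Fin.sum_univ_succ, shiftCoeff, hn]
  ring

theorem linSubst_lower (t : ℂ) (a : Fin 9 → ℂ) :
    linSubst 1 0 t 1 (formPoly 8 a) = formPoly 8 (revCoeff (shiftCoeff t (revCoeff a))) := by
  have hn (n : ℕ) [n.AtLeastTwo] : (C (OfNat.ofNat n) : MvPolynomial (Fin 2) ℂ) = OfNat.ofNat n :=
    map_ofNat _ n
  simp only [formPoly, map_sum, map_mul, map_pow, linSubst_C, linSubst_X_zero, linSubst_X_one]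
  simp [Fin.sum_univ_succ, shiftCoeff, revCoeff, Fin.rev, hn]
  ring

theorem exists_linSubst_decomp (p q r s : ℂ) (h : p * s - q * r = 1) :
    ∃ t₁ t₂ t₃ t₄ : ℂ, linSubst p q r s = (linSubst 1 0 t₁ 1).comp ((linSubst 1 t₂ 0 1).comp
      ((linSubst 1 0 t₃ 1).comp (linSubst 1 t₄ 0 1))) := by
  have key : ∃ t : ℂ, r - s * t ≠ 0 := by
    by_cases hr : r = 0
    · refine ⟨1, fun hs => ?_⟩
      have : s = 0 := by linear_combination hr - hs
      simp [hr, this] at h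
    · exact ⟨0, by simpa using hr⟩
  obtain ⟨t, ht⟩ := key
  obtain ⟨d, hd⟩ : ∃ d, d = r - s * t := ⟨_, rfl⟩
  obtain rfl : r = d + s * t := by rw [hd]; ring
  rw [add_sub_cancel_right] at ht
  refine ⟨t, (s - 1) / d, d, (p - q * t - 1) / d, ?_⟩
  simp only [linSubst_comp]
  congr 1
  · field_simp
    linear_combination (-t) * h
  · field_simp
    linear_combination -h
  · field_simp
    ring
  · field_simp
    ring

theorem mem_invariantRing_iff (p : MvPolynomial (Fin 9) ℂ) :
    p ∈ invariantRing 8 ↔ raiseD p = 0 ∧ lowerD p = 0 := by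
  constructor
  · intro h
    have hS (p q r s : ℂ) (a b : Fin 9 → ℂ) (hd : p * s - q * r = 1)
        (hb : linSubst p q r s (formPoly 8 a) = formPoly 8 b) :
        ∃ g : Matrix.SpecialLinearGroup (Fin 2) ℂ, sl2Act 8 g a = b :=
      ⟨⟨!![p, q; r, s], by rw [Matrix.det_fin_two_of, hd]⟩, sl2Act_eq_of_linSubst _ a b hb⟩
    constructor
    · rw [raiseD_eq_zero_iff]
      intro t a
      obtain ⟨g, hg⟩ := hS 1 t 0 1 a _ (by ring) (linSubst_shift t a)
      rw [← hg]
      exact h g a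
    · rw [lowerD_eq_zero_iff]
      intro t a
      obtain ⟨g, hg⟩ := hS 1 0 t 1 a _ (by ring) (linSubst_lower t a)
      rw [← hg]
      exact h g a
  · rintro ⟨h1, h2⟩ g a
    rw [raiseD_eq_zero_iff] at h1
    rw [lowerD_eq_zero_iff] at h2
    have hd : g.1 0 0 * g.1 1 1 - g.1 0 1 * g.1 1 0 = 1 := by
      rw [← Matrix.det_fin_two]; exact g.2
    obtain ⟨t₁, t₂, t₃, t₄, ht⟩ := exists_linSubst_decomp _ _ _ _ hd
    have := sl2Act_eq_of_linSubst g a (revCoeff (shiftCoeff t₁ (revCoeff (shiftCoeff t₂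
      (revCoeff (shiftCoeff t₃ (revCoeff (shiftCoeff t₄ a)))))))) (by
        rw [ht]
        simp only [AlgHom.comp_apply]
        rw [linSubst_shift, linSubst_lower, linSubst_shift, linSubst_lower])
    rw [this, h2, h1, h2, h1]

/-- The torus weights of the coefficients of an octavic. -/
def coeffWeight (i : Fin 9) : ℤ := 8 - 2 * (i : ℤ)

theorem weightD_monomial (s : Fin 9 →₀ ℕ) (c : ℂ) :
    weightD (monomial s c) = ((Finsupp.weight coeffWeight s : ℤ) : ℂ) • monomial s c := by
  have hX (i : Fin 9) : weightD (X i) = (coeffWeight i : ℂ) • X i := by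
    have hC (n : ℕ) [n.AtLeastTwo] : (C (OfNat.ofNat n) : MvPolynomial (Fin 9) ℂ) = OfNat.ofNat n :=
      map_ofNat _ n
    simp only [weightD, mkDerivation_X, MvPolynomial.smul_eq_C_mul]
    fin_cases i <;> norm_num [coeffWeight, hC] <;> rfl
  induction s using Finsupp.induction_linear generalizing c with
  | zero => simp [weightD]
  | add s t hs ht =>
    have h : monomial (s + t) c = monomial s c * monomial t (1 : ℂ) := by simp [monomial_mul]
    rw [h, Derivation.leibniz, hs, ht, map_add]
    simp only [smul_eq_mul, MvPolynomial.smul_eq_C_mul, Int.cast_add, map_add]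
    ring
  | single i n =>
    have h : monomial (Finsupp.single i n) c = C c * X i ^ n := by
      rw [X_pow_eq_monomial, C_mul_monomial, mul_one]
    rw [h, Derivation.leibniz, derivation_C, smul_zero, add_zero, Derivation.leibniz_pow, hX,
      Finsupp.weight_single]
    rcases n with _ | n
    · simp
    · simp only [MvPolynomial.smul_eq_C_mul, smul_eq_mul, nsmul_eq_mul, Nat.add_sub_cancel]
      push_cast
      simp only [map_mul, map_add, map_natCast, map_one]
      ring

theorem coeff_weightD (m : Fin 9 →₀ ℕ) (p : MvPolynomial (Fin 9) ℂ) :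
    coeff m (weightD p) = ((Finsupp.weight coeffWeight m : ℤ) : ℂ) * coeff m p := by
  induction p using MvPolynomial.induction_on' with
  | monomial s c =>
    rw [weightD_monomial, coeff_smul, coeff_monomial, smul_eq_mul]
    split_ifs with h
    · rw [h]
    · simp
  | add p q hp hq => rw [map_add, coeff_add, hp, hq, coeff_add, mul_add]

theorem isWeightedHomogeneous_of_weightD_eq_zero {p : MvPolynomial (Fin 9) ℂ} (h : weightD p = 0) :
    IsWeightedHomogeneous coeffWeight p 0 := by
  intro m hm
  have h1 := coeff_weightD m p
  rw [h, coeff_zero, eq_comm, mul_eq_zero] at h1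
  exact_mod_cast h1.resolve_right hm

/-- The projection onto the polynomials of torus weight zero. -/
def weightZero : MvPolynomial (Fin 9) ℂ →ₗ[ℂ] MvPolynomial (Fin 9) ℂ :=
  weightedHomogeneousComponent coeffWeight 0

theorem weightD_weightZero (p : MvPolynomial (Fin 9) ℂ) : weightD (weightZero p) = 0 := by
  ext m
  rw [coeff_weightD, weightZero, coeff_weightedHomogeneousComponent, coeff_zero]
  split_ifs with h
  · simp [h]
  · simp

theorem weightZero_eq_self {p : MvPolynomial (Fin 9) ℂ} (h : weightD p = 0) : weightZero p = p :=
  (isWeightedHomogeneous_of_weightD_eq_zero h).weightedHomogeneousComponent_same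

theorem weightZero_mul (q : MvPolynomial (Fin 9) ℂ) {p : MvPolynomial (Fin 9) ℂ}
    (h : weightD p = 0) : weightZero (q * p) = weightZero q * p := by
  have hp := isWeightedHomogeneous_of_weightD_eq_zero h
  induction q using MvPolynomial.induction_on' with
  | monomial s c =>
    have hs : IsWeightedHomogeneous coeffWeight (monomial s c) (Finsupp.weight coeffWeight s) :=
      isWeightedHomogeneous_monomial _ _ _ rfl
    have hsp := hs.mul hp
    rw [add_zero] at hsp
    by_cases hw : Finsupp.weight coeffWeight s = 0
    · rw [hw] at hs hsp
      rw [weightZero, hs.weightedHomogeneousComponent_same, hsp.weightedHomogeneousComponent_same]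
    · rw [weightZero, hs.weightedHomogeneousComponent_ne _ (Ne.symm hw),
        hsp.weightedHomogeneousComponent_ne _ (Ne.symm hw), zero_mul]
  | add p q hp hq => rw [add_mul, map_add, hp, hq, map_add, add_mul]

theorem raiseD_lowerD (p : MvPolynomial (Fin 9) ℂ) :
    raiseD (lowerD p) = lowerD (raiseD p) + weightD p := by
  rw [← lie_raiseD_lowerD, Derivation.commutator_apply]
  ring

theorem weightD_raiseD (p : MvPolynomial (Fin 9) ℂ) :
    weightD (raiseD p) = raiseD (weightD p) + (2 : ℂ) • raiseD p := by
  have h : ⁅weightD, raiseD⁆ = (2 : ℂ) • raiseD := by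
    apply derivation_ext
    intro i
    have h (n : ℕ) [n.AtLeastTwo] (D : Derivation ℂ (MvPolynomial (Fin 9) ℂ) (MvPolynomial (Fin 9) ℂ)) :
      D (OfNat.ofNat n) = 0 := D.map_natCast n
    have hC (n : ℕ) [n.AtLeastTwo] : (C (OfNat.ofNat n) : MvPolynomial (Fin 9) ℂ) = OfNat.ofNat n :=
      map_ofNat _ n
    fin_cases i <;> simp [Derivation.commutator_apply, raiseD, weightD, mkDerivation_X, h, hC,
      MvPolynomial.smul_eq_C_mul] <;> ring
  have := DFunLike.congr_fun h p
  rw [Derivation.commutator_apply, Derivation.smul_apply] at this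
  rw [← this]
  ring

theorem weightD_lowerD (p : MvPolynomial (Fin 9) ℂ) :
    weightD (lowerD p) = lowerD (weightD p) - (2 : ℂ) • lowerD p := by
  have h : ⁅weightD, lowerD⁆ = (-2 : ℂ) • lowerD := by
    apply derivation_ext
    intro i
    have h (n : ℕ) [n.AtLeastTwo] (D : Derivation ℂ (MvPolynomial (Fin 9) ℂ) (MvPolynomial (Fin 9) ℂ)) :
      D (OfNat.ofNat n) = 0 := D.map_natCast n
    have hC (n : ℕ) [n.AtLeastTwo] : (C (OfNat.ofNat n) : MvPolynomial (Fin 9) ℂ) = OfNat.ofNat n :=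
      map_ofNat _ n
    fin_cases i <;> simp [Derivation.commutator_apply, lowerD, weightD, mkDerivation_X, h, hC,
      MvPolynomial.smul_eq_C_mul] <;> ring
  have := DFunLike.congr_fun h p
  rw [Derivation.commutator_apply, Derivation.smul_apply] at this
  rw [sub_eq_add_neg, ← neg_smul, ← this]
  ring

theorem weightD_lowerD_iterate {p : MvPolynomial (Fin 9) ℂ} {c : ℂ} (h : weightD p = c • p)
    (k : ℕ) : weightD (lowerD^[k] p) = (c - 2 * k) • lowerD^[k] p := by
  induction k with
  | zero => simpa using h
  | succ k ih =>
    rw [Function.iterate_succ_apply', weightD_lowerD, ih, Derivation.map_smul, ← sub_smul]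
    congr 1
    push_cast
    ring

theorem weightD_raiseD_iterate {p : MvPolynomial (Fin 9) ℂ} (h : weightD p = 0)
    (k : ℕ) : weightD (raiseD^[k] p) = (2 * k : ℂ) • raiseD^[k] p := by
  induction k with
  | zero => simpa using h
  | succ k ih =>
    rw [Function.iterate_succ_apply', weightD_raiseD, ih, Derivation.map_smul, ← add_smul]
    congr 1
    push_cast
    ring

theorem raiseD_lowerD_iterate {p : MvPolynomial (Fin 9) ℂ} {c : ℂ} (h : weightD p = c • p)
    (k : ℕ) : raiseD (lowerD^[k + 1] p) =
      lowerD^[k + 1] (raiseD p) + ((k + 1) * (c - k) : ℂ) • lowerD^[k] p := by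
  induction k with
  | zero =>
    simp only [zero_add, Function.iterate_one, Function.iterate_zero, id]
    rw [raiseD_lowerD, h]
    simp
  | succ k ih =>
    rw [Function.iterate_succ_apply', raiseD_lowerD, ih, map_add, Derivation.map_smul,
      weightD_lowerD_iterate h, ← Function.iterate_succ_apply' lowerD,
      ← Function.iterate_succ_apply' lowerD, add_assoc, ← add_smul]
    congr 2
    push_cast
    ring

/-- The truncated extremal projector of `sl₂`. -/
def extremal (N : ℕ) (p : MvPolynomial (Fin 9) ℂ) : MvPolynomial (Fin 9) ℂ :=
  ∑ k ∈ Finset.range N, ((-1 : ℂ) ^ k / (k.factorial * (k + 1).factorial)) •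
    lowerD^[k] (raiseD^[k] p)

theorem raiseD_extremal {p : MvPolynomial (Fin 9) ℂ} (h : weightD p = 0) (N : ℕ) :
    raiseD (extremal (N + 1) p) = ((-1 : ℂ) ^ N / (N.factorial * (N + 1).factorial)) •
      lowerD^[N] (raiseD^[N + 1] p) := by
  induction N with
  | zero => simp [extremal]
  | succ N ih =>
    rw [extremal, Finset.sum_range_succ, ← extremal, map_add, ih, Derivation.map_smul,
      raiseD_lowerD_iterate (weightD_raiseD_iterate h (N + 1)), smul_add, add_comm, add_assoc,
      smul_smul, ← add_smul, ← Function.iterate_succ_apply' raiseD]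
    convert add_zero _
    rw [smul_eq_zero]
    left
    have h1 : (N.factorial : ℂ) ≠ 0 := by exact_mod_cast N.factorial_ne_zero
    have h2 : (N : ℂ) + 1 ≠ 0 := by exact_mod_cast N.succ_ne_zero
    have h3 : (N : ℂ) + 1 + 1 ≠ 0 := by exact_mod_cast (N + 1).succ_ne_zero
    simp only [Nat.factorial_succ]
    push_cast
    field_simp
    ring

theorem lowerD_eq_zero_of_raiseD_eq_zero {p : MvPolynomial (Fin 9) ℂ} (h : weightD p = 0)
    (hr : raiseD p = 0) : lowerD p = 0 := by
  obtain ⟨n, hn⟩ := lowerD_iterate_eq_zero p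
  have key : ∀ m, lowerD^[m + 1] p = 0 → lowerD p = 0 := by
    intro m
    induction m with
    | zero => intro h; simpa using h
    | succ m ih =>
      intro hm
      have h1 := raiseD_lowerD_iterate (c := 0) (by rw [h, zero_smul]) (m + 1) (p := p)
      rw [hm, map_zero, hr, iterate_map_zero, zero_add, eq_comm, smul_eq_zero] at h1
      refine ih (h1.resolve_left ?_)
      have h2 : ((m : ℂ) + 1) ≠ 0 := by exact_mod_cast m.succ_ne_zero
      have h3 : (m : ℂ) + 1 + 1 ≠ 0 := by exact_mod_cast (m + 1).succ_ne_zero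
      push_cast
      rw [zero_sub]
      exact mul_ne_zero h3 (neg_ne_zero.mpr h2)
  exact key n (hn _ (by omega))

theorem extremal_mem {p : MvPolynomial (Fin 9) ℂ} (h : weightD p = 0) {N : ℕ}
    (hN : raiseD^[N + 1] p = 0) : extremal (N + 1) p ∈ invariantRing 8 := by
  rw [mem_invariantRing_iff]
  have hr : raiseD (extremal (N + 1) p) = 0 := by
    rw [raiseD_extremal h, hN, iterate_map_zero, smul_zero]
  refine ⟨hr, lowerD_eq_zero_of_raiseD_eq_zero ?_ hr⟩
  rw [extremal, map_sum]
  refine Finset.sum_eq_zero fun k _ => ?_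
  rw [Derivation.map_smul, weightD_lowerD_iterate (weightD_raiseD_iterate h k)]
  simp

theorem weightD_eq_zero_of_mem {p : MvPolynomial (Fin 9) ℂ} (h : p ∈ invariantRing 8) :
    weightD p = 0 := by
  rw [mem_invariantRing_iff] at h
  have := raiseD_lowerD p
  rw [h.1, h.2, map_zero, map_zero, zero_add] at this
  exact this.symm

theorem extremal_mul (N : ℕ) (q : MvPolynomial (Fin 9) ℂ) {p : MvPolynomial (Fin 9) ℂ}
    (h : p ∈ invariantRing 8) : extremal N (q * p) = extremal N q * p := by
  rw [mem_invariantRing_iff] at h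
  have h1 (q : MvPolynomial (Fin 9) ℂ) (k : ℕ) : raiseD^[k] (q * p) = raiseD^[k] q * p := by
    induction k with
    | zero => rfl
    | succ k ih =>
      rw [Function.iterate_succ_apply', ih, Derivation.leibniz, h.1, Function.iterate_succ_apply']
      simp [mul_comm]
  have h2 (q : MvPolynomial (Fin 9) ℂ) (k : ℕ) : lowerD^[k] (q * p) = lowerD^[k] q * p := by
    induction k with
    | zero => rfl
    | succ k ih =>
      rw [Function.iterate_succ_apply', ih, Derivation.leibniz, h.2, Function.iterate_succ_apply']
      simp [mul_comm]
  simp only [extremal, h1, h2, Finset.sum_mul, smul_mul_assoc]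

theorem extremal_eq_self {p : MvPolynomial (Fin 9) ℂ} (h : p ∈ invariantRing 8) (N : ℕ) :
    extremal (N + 1) p = p := by
  rw [mem_invariantRing_iff] at h
  rw [extremal, Finset.sum_range_succ', Finset.sum_eq_zero]
  · simp
  · intro k _
    rw [Function.iterate_succ_apply, Function.iterate_succ_apply, h.1, iterate_map_zero, map_zero,
      iterate_map_zero, smul_zero]

theorem extremal_sum {ι : Type*} (s : Finset ι) (N : ℕ) (g : ι → MvPolynomial (Fin 9) ℂ) :
    extremal N (∑ i ∈ s, g i) = ∑ i ∈ s, extremal N (g i) := by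
  have h1 (k : ℕ) : raiseD^[k] (∑ i ∈ s, g i) = ∑ i ∈ s, raiseD^[k] (g i) := by
    induction k with
    | zero => rfl
    | succ k ih => simp only [Function.iterate_succ_apply', ih, map_sum]
  have h2 (f : ι → MvPolynomial (Fin 9) ℂ) (k : ℕ) :
      lowerD^[k] (∑ i ∈ s, f i) = ∑ i ∈ s, lowerD^[k] (f i) := by
    induction k with
    | zero => rfl
    | succ k ih => simp only [Function.iterate_succ_apply', ih, map_sum]
  simp only [extremal, h1, h2, Finset.smul_sum]
  exact Finset.sum_comm

theorem mkDerivation_eq_sum (f : Fin 9 → MvPolynomial (Fin 9) ℂ) (p : MvPolynomial (Fin 9) ℂ) :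
    MvPolynomial.mkDerivation ℂ f p = ∑ i, f i * pderiv i p := by
  have hs (q : MvPolynomial (Fin 9) ℂ) : (∑ i, f i • pderiv i :
      Derivation ℂ (MvPolynomial (Fin 9) ℂ) (MvPolynomial (Fin 9) ℂ)) q = ∑ i, f i * pderiv i q := by
    have := congrFun (map_sum (Derivation.coeFnAddMonoidHom (R := ℂ) (A := MvPolynomial (Fin 9) ℂ)
      (M := MvPolynomial (Fin 9) ℂ)) (fun i => f i • pderiv i) Finset.univ) q
    rw [Finset.sum_apply] at this
    exact this
  rw [← hs]
  refine congrFun (congrArg _ ?_) p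
  apply derivation_ext
  intro j
  rw [mkDerivation_X, hs, Finset.sum_eq_single j]
  · simp
  · intro i _ hi
    simp [pderiv_X_of_ne hi.symm]
  · simp

theorem IsHomogeneous.mkDerivation {f : Fin 9 → MvPolynomial (Fin 9) ℂ}
    (hf : ∀ i, (f i).IsHomogeneous 1) {p : MvPolynomial (Fin 9) ℂ} {d : ℕ} (hp : p.IsHomogeneous d) :
    (MvPolynomial.mkDerivation ℂ f p).IsHomogeneous d := by
  rcases d with _ | d
  · rw [← mem_homogeneousSubmodule, homogeneousSubmodule_zero, Submodule.mem_one] at hp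
    obtain ⟨c, rfl⟩ := hp
    rw [algebraMap_eq, derivation_C]
    exact isHomogeneous_zero _ _ _
  · rw [mkDerivation_eq_sum]
    apply IsHomogeneous.sum
    intro i _
    rw [add_comm]
    exact (hf i).mul hp.pderiv

theorem mkDerivation_homogeneousComponent_eq_zero {f : Fin 9 → MvPolynomial (Fin 9) ℂ}
    (hf : ∀ i, (f i).IsHomogeneous 1) {p : MvPolynomial (Fin 9) ℂ}
    (h : MvPolynomial.mkDerivation ℂ f p = 0) (d : ℕ) :
    MvPolynomial.mkDerivation ℂ f (homogeneousComponent d p) = 0 := by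
  rw [← sum_homogeneousComponent p, map_sum] at h
  have h1 := congrArg (homogeneousComponent d) h
  rw [map_sum, map_zero] at h1
  have h2 (i : ℕ) : homogeneousComponent d (MvPolynomial.mkDerivation ℂ f (homogeneousComponent i p))
      = if i = d then MvPolynomial.mkDerivation ℂ f (homogeneousComponent d p) else 0 := by
    rw [homogeneousComponent_of_mem (IsHomogeneous.mkDerivation hf (homogeneousComponent_isHomogeneous i p))]
    by_cases hi : i = d
    · simp [hi]
    · simp [hi, Ne.symm hi]
  simp only [h2, Finset.sum_ite_eq', Finset.mem_range] at h1
  split_ifs at h1 with hd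
  · exact h1
  · rw [homogeneousComponent_eq_zero _ _ (by omega), map_zero]

theorem homogeneousComponent_mem {p : MvPolynomial (Fin 9) ℂ} (h : p ∈ invariantRing 8) (d : ℕ) :
    homogeneousComponent d p ∈ invariantRing 8 := by
  rw [mem_invariantRing_iff] at h ⊢
  have hc (n : ℕ) [n.AtLeastTwo] (i : Fin 9) :
      (OfNat.ofNat n * X i : MvPolynomial (Fin 9) ℂ).IsHomogeneous 1 := by
    have := (isHomogeneous_X ℂ i).C_mul (OfNat.ofNat n)
    rwa [map_ofNat C] at this
  constructor
  · refine mkDerivation_homogeneousComponent_eq_zero (fun i => ?_) h.1 d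
    fin_cases i <;> first | exact hc _ _ | exact isHomogeneous_X _ _ | exact isHomogeneous_zero _ _ _
  · refine mkDerivation_homogeneousComponent_eq_zero (fun i => ?_) h.2 d
    fin_cases i <;> first | exact hc _ _ | exact isHomogeneous_X _ _ | exact isHomogeneous_zero _ _ _

theorem homogeneousComponent_mul_of_isHomogeneous (q : MvPolynomial (Fin 9) ℂ)
    {s : MvPolynomial (Fin 9) ℂ} {e : ℕ} (hs : s.IsHomogeneous e) (d : ℕ) :
    homogeneousComponent d (q * s) = if e ≤ d then homogeneousComponent (d - e) q * s else 0 := by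
  induction q using MvPolynomial.induction_on' with
  | monomial m c =>
    have hm : (monomial m c).IsHomogeneous m.degree := isHomogeneous_monomial _ rfl
    rw [homogeneousComponent_of_mem (hm.mul hs), homogeneousComponent_of_mem hm]
    split_ifs <;> first | rfl | omega
  | add p q hp hq =>
    rw [add_mul, map_add, hp, hq]
    split_ifs <;> simp [add_mul]

theorem exists_invariant_coefficients {ι : Type*} [Fintype ι] (s : ι → MvPolynomial (Fin 9) ℂ)
    (e : ι → ℕ) (hs : ∀ i, s i ∈ invariantRing 8) (he : ∀ i, (s i).IsHomogeneous (e i))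
    {h : MvPolynomial (Fin 9) ℂ} {d : ℕ} (hh : h ∈ invariantRing 8) (hd : h.IsHomogeneous d)
    (hspan : h ∈ Ideal.span (Set.range s)) :
    ∃ g : ι → MvPolynomial (Fin 9) ℂ, (∀ i, g i ∈ invariantRing 8) ∧
      (∀ i, (g i).IsHomogeneous (d - e i)) ∧ (∀ i, d < e i → g i = 0) ∧ h = ∑ i, g i * s i := by
  rw [Ideal.mem_span_range_iff_exists_fun] at hspan
  obtain ⟨g, hg⟩ := hspan
  have hN : ∃ N, ∀ i, raiseD^[N + 1] (weightZero (g i)) = 0 := by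
    choose n hn using fun i => raiseD_iterate_eq_zero (weightZero (g i))
    exact ⟨Finset.univ.sup n, fun i => hn i _ ((Finset.le_sup (Finset.mem_univ i)).trans (Nat.le_succ _))⟩
  obtain ⟨N, hN⟩ := hN
  have h1 : h = ∑ i, extremal (N + 1) (weightZero (g i)) * s i := by
    rw [← extremal_eq_self hh N, ← weightZero_eq_self (weightD_eq_zero_of_mem hh), ← hg, map_sum,
      extremal_sum]
    refine Finset.sum_congr rfl fun i _ => ?_
    rw [weightZero_mul _ (weightD_eq_zero_of_mem (hs i)), extremal_mul _ _ (hs i)]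
  refine ⟨fun i => if e i ≤ d then homogeneousComponent (d - e i)
    (extremal (N + 1) (weightZero (g i))) else 0, fun i => ?_, fun i => ?_, fun i hi => ?_, ?_⟩
  · dsimp only
    split_ifs
    · exact homogeneousComponent_mem (extremal_mem (weightD_weightZero _) (hN i)) _
    · exact zero_mem _
  · dsimp only
    split_ifs
    · exact homogeneousComponent_isHomogeneous _ _
    · exact isHomogeneous_zero _ _ _
  · dsimp only
    rw [if_neg (by omega)]
  · have h2 := congrArg (homogeneousComponent d) h1
    rw [homogeneousComponent_of_mem hd, if_pos rfl, map_sum] at h2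
    rw [h2]
    refine Finset.sum_congr rfl fun i _ => ?_
    rw [homogeneousComponent_mul_of_isHomogeneous _ (he i)]
    by_cases hi : e i ≤ d
    · simp only [if_pos hi]
    · simp only [if_neg hi, zero_mul]

/-- The homogeneous invariants of positive degree. -/
def positiveInvariants : Set (MvPolynomial (Fin 9) ℂ) :=
  {h | h ∈ invariantRing 8 ∧ ∃ d, 0 < d ∧ h.IsHomogeneous d}

theorem exists_degree_bound_mem_pow :
    ∃ e : ℕ, ∀ k d (h : MvPolynomial (Fin 9) ℂ), h ∈ invariantRing 8 → h.IsHomogeneous d → k * e < d →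
      h ∈ Ideal.span positiveInvariants ^ (k + 1) := by
  have hfg : (Ideal.span positiveInvariants).FG := IsNoetherian.noetherian _
  obtain ⟨T, hT, hTs⟩ := (Submodule.fg_span_iff_fg_span_finset_subset positiveInvariants).mp hfg
  have hT' : ∀ t : T, (t : MvPolynomial (Fin 9) ℂ) ∈ invariantRing 8 ∧
      ∃ d, 0 < d ∧ (t : MvPolynomial (Fin 9) ℂ).IsHomogeneous d := fun t => hT t.2
  choose hTi e he0 he using hT'
  refine ⟨Finset.univ.sup e, fun k => ?_⟩
  induction k with
  | zero =>
    intro d h hh hd hk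
    rw [zero_add, pow_one]
    exact Ideal.subset_span ⟨hh, d, by omega, hd⟩
  | succ k ih =>
    intro d h hh hd hk
    have h0 : 0 < d := by omega
    have h1 : h ∈ Ideal.span (Set.range fun t : T => (t : MvPolynomial (Fin 9) ℂ)) := by
      have : Ideal.span (Set.range fun t : T => (t : MvPolynomial (Fin 9) ℂ)) = Ideal.span positiveInvariants := by
        rw [Subtype.range_coe_subtype]
        exact hTs.symm
      rw [this]
      exact Ideal.subset_span ⟨hh, d, h0, hd⟩
    obtain ⟨g, hg1, hg2, hg3, rfl⟩ := exists_invariant_coefficients _ e hTi he hh hd h1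
    refine Ideal.sum_mem _ fun t _ => ?_
    rw [pow_succ]
    refine Ideal.mul_mem_mul (ih _ _ (hg1 t) (hg2 t) ?_) (Ideal.subset_span (hT t.2))
    have : e t ≤ Finset.univ.sup e := Finset.le_sup (Finset.mem_univ t)
    rw [add_mul] at hk
    omega

theorem exists_degree_bound_mem_span {ι : Type*} (p : ι → MvPolynomial (Fin 9) ℂ)
    (hp : ∀ a : Fin 9 → ℂ, (∀ i, eval a (p i) = 0) → ∀ h ∈ positiveInvariants, eval a h = 0) :
    ∃ D : ℕ, ∀ d (h : MvPolynomial (Fin 9) ℂ), h ∈ invariantRing 8 → h.IsHomogeneous d → D < d →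
      h ∈ Ideal.span (Set.range p) := by
  have h1 : Ideal.span positiveInvariants ≤ (Ideal.span (Set.range p)).radical := by
    rw [← vanishingIdeal_zeroLocus_eq_radical (K := ℂ), Ideal.span_le]
    intro h hh
    rw [SetLike.mem_coe, mem_vanishingIdeal_iff]
    intro a ha
    rw [zeroLocus_span] at ha
    have := hp a (fun i => by simpa [coe_aeval_eq_eval] using ha (p i) ⟨i, rfl⟩) h hh
    simpa [coe_aeval_eq_eval] using this
  obtain ⟨K, hK⟩ := Ideal.exists_pow_le_of_le_radical_of_fg h1 (IsNoetherian.noetherian _)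
  obtain ⟨e, he⟩ := exists_degree_bound_mem_pow
  exact ⟨K * e, fun d h hh hd hdk => hK (Ideal.pow_le_pow_right (Nat.le_succ K) (he K d h hh hd hdk))⟩

theorem finite_of_nullcone {ι : Type*} [Fintype ι] (p : ι → invariantRing 8) (e : ι → ℕ)
    (he0 : ∀ i, 0 < e i) (he : ∀ i, (p i : MvPolynomial (Fin 9) ℂ).IsHomogeneous (e i))
    (hp : ∀ a : Fin 9 → ℂ, (∀ i, eval a (p i : MvPolynomial (Fin 9) ℂ) = 0) →
      ∀ h ∈ positiveInvariants, eval a h = 0) :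
    Module.Finite (Algebra.adjoin ℂ (Set.range p)) (invariantRing 8) := by
  obtain ⟨D, hD⟩ := exists_degree_bound_mem_span (fun i => (p i : MvPolynomial (Fin 9) ℂ)) hp
  let L : Submodule ℂ (invariantRing 8) :=
    (restrictTotalDegree (Fin 9) ℂ D).comap (invariantRing 8).val.toLinearMap
  have hL : L.FG := by
    rw [← Module.Finite.iff_fg]
    let f : L →ₗ[ℂ] restrictTotalDegree (Fin 9) ℂ D :=
      ((invariantRing 8).val.toLinearMap.comp L.subtype).codRestrict _ fun x => x.2
    refine Module.Finite.of_injective f fun x y hxy => ?_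
    have := congrArg Subtype.val hxy
    exact Subtype.ext (Subtype.ext this)
  obtain ⟨S, hS⟩ := hL
  refine ⟨⟨S, ?_⟩⟩
  set A := Algebra.adjoin ℂ (Set.range p)
  have hLS : ∀ x ∈ L, x ∈ Submodule.span A (S : Set (invariantRing 8)) := by
    intro x hx
    rw [← hS] at hx
    exact Submodule.span_le_restrictScalars ℂ A _ hx
  have key : ∀ d (x : invariantRing 8), (x : MvPolynomial (Fin 9) ℂ).IsHomogeneous d →
      x ∈ Submodule.span A (S : Set (invariantRing 8)) := by
    intro d
    induction d using Nat.strong_induction_on with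
    | _ d ih =>
      intro x hx
      by_cases hd : d ≤ D
      · apply hLS
        rw [Submodule.mem_comap, mem_restrictTotalDegree]
        exact hx.totalDegree_le.trans hd
      · obtain ⟨g, hg1, hg2, hg3, hg4⟩ := exists_invariant_coefficients _ e (fun i => (p i).2) he x.2 hx
          (hD d x x.2 hx (by omega))
        have hx' : x = ∑ i, (⟨p i, Algebra.subset_adjoin ⟨i, rfl⟩⟩ : A) • (⟨g i, hg1 i⟩ : invariantRing 8) := by
          apply Subtype.ext
          rw [hg4, AddSubmonoidClass.coe_finsetSum]
          refine Finset.sum_congr rfl fun i _ => ?_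
          rw [mul_comm]
          rfl
        rw [hx']
        refine Submodule.sum_mem _ fun i _ => Submodule.smul_mem _ _ (ih (d - e i) ?_ _ (hg2 i))
        have := he0 i
        omega
  rw [eq_top_iff]
  intro x _
  have hx : x = ∑ i ∈ Finset.range ((x : MvPolynomial (Fin 9) ℂ).totalDegree + 1),
      (⟨homogeneousComponent i (x : MvPolynomial (Fin 9) ℂ), homogeneousComponent_mem x.2 i⟩ : invariantRing 8) := by
    apply Subtype.ext
    rw [AddSubmonoidClass.coe_finsetSum]
    exact (sum_homogeneousComponent _).symm
  rw [hx]
  exact Submodule.sum_mem _ fun i _ => key i _ (homogeneousComponent_isHomogeneous _ _)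

/-- The invariant pairing on binary quartics, in normalized coefficients. -/
def quarticPairing {R : Type*} [CommRing R] (u v : Fin 5 → R) : R :=
  u 0 * v 4 - 4 * u 1 * v 3 + 6 * u 2 * v 2 - 4 * u 3 * v 1 + u 4 * v 0

/-- The equivariant endomorphism of the space of quartics attached to an octavic with
normalized coefficients `a`. -/
def quarticOp {R : Type*} [CommRing R] (a : Fin 9 → R) (u : Fin 5 → R) : Fin 5 → R :=
  ![a 0 * u 4 - 4 * a 1 * u 3 + 6 * a 2 * u 2 - 4 * a 3 * u 1 + a 4 * u 0,
    a 1 * u 4 - 4 * a 2 * u 3 + 6 * a 3 * u 2 - 4 * a 4 * u 1 + a 5 * u 0,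
    a 2 * u 4 - 4 * a 3 * u 3 + 6 * a 4 * u 2 - 4 * a 5 * u 1 + a 6 * u 0,
    a 3 * u 4 - 4 * a 4 * u 3 + 6 * a 5 * u 2 - 4 * a 6 * u 1 + a 7 * u 0,
    a 4 * u 4 - 4 * a 5 * u 3 + 6 * a 6 * u 2 - 4 * a 7 * u 1 + a 8 * u 0]

/-- The quadratic quartic covariant of an octavic (six times the sixth transvectant). -/
def quarticCov {R : Type*} [CommRing R] (a : Fin 9 → R) : Fin 5 → R :=
  ![6 * (a 0 * a 6 - 6 * a 1 * a 5 + 15 * a 2 * a 4 - 10 * a 3 ^ 2),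
    3 * (a 0 * a 7 - 5 * a 1 * a 6 + 9 * a 2 * a 5 - 5 * a 3 * a 4),
    a 0 * a 8 - 2 * a 1 * a 7 - 8 * a 2 * a 6 + 34 * a 3 * a 5 - 25 * a 4 ^ 2,
    3 * (a 1 * a 8 - 5 * a 2 * a 7 + 9 * a 3 * a 6 - 5 * a 4 * a 5),
    6 * (a 2 * a 8 - 6 * a 3 * a 7 + 15 * a 4 * a 6 - 10 * a 5 ^ 2)]

/-- Twelve times the Hessian of a quartic. -/
def quarticHess {R : Type*} [CommRing R] (u : Fin 5 → R) : Fin 5 → R :=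
  ![12 * (u 0 * u 2 - u 1 ^ 2), 6 * (u 0 * u 3 - u 1 * u 2),
    2 * u 0 * u 4 + 4 * u 1 * u 3 - 6 * u 2 ^ 2, 6 * (u 1 * u 4 - u 2 * u 3),
    12 * (u 2 * u 4 - u 3 ^ 2)]

/-- The cubic invariant of an octavic: the trace of the cube of `quarticOp a`. -/
def cubicInv {R : Type*} [CommRing R] (a : Fin 9 → R) : R :=
  6 * a 0 * a 4 * a 8 - 24 * a 0 * a 5 * a 7 + 18 * a 0 * a 6 ^ 2 - 24 * a 1 * a 3 * a 8 + 72 * a 1 * a 4 * a 7 - 48 * a 1 * a 5 * a 6 + 18 * a 2 ^ 2 * a 8 - 48 * a 2 * a 3 * a 7 - 132 * a 2 * a 4 * a 6 + 144 * a 2 * a 5 ^ 2 + 144 * a 3 ^ 2 * a 6 - 216 * a 3 * a 4 * a 5 + 90 * a 4 ^ 3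

/-- The basic invariants of degrees `2, …, 10` of the octavic with normalized
coefficients `a`. -/
def octInv {R : Type*} [CommRing R] (a : Fin 9 → R) : ℕ → R
  | 2 => a 0 * a 8 - 8 * a 1 * a 7 + 28 * a 2 * a 6 - 56 * a 3 * a 5 + 35 * a 4 ^ 2
  | 3 => cubicInv a
  | 4 => quarticPairing (quarticCov a) (quarticCov a)
  | 5 => quarticPairing (quarticCov a) (quarticOp a (quarticCov a))
  | 6 => quarticPairing (quarticCov a) (quarticHess (quarticCov a))
  | 7 => quarticPairing (quarticOp a (quarticCov a)) (quarticHess (quarticCov a))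
  | 8 => quarticPairing (quarticOp a (quarticOp a (quarticCov a))) (quarticHess (quarticCov a))
  | 9 => quarticPairing (quarticOp a (quarticHess (quarticCov a))) (quarticHess (quarticCov a))
  | 10 => quarticPairing (quarticOp a (quarticOp a (quarticHess (quarticCov a))))
      (quarticHess (quarticCov a))
  | _ => 0

/-- The normalized coefficients of `f(x + t y, y)`. -/
def shiftNorm {R : Type*} [CommRing R] (t : R) (a : Fin 9 → R) : Fin 9 → R :=
  ![a 0,
    a 1 + t * a 0,
    a 2 + 2 * t * a 1 + t ^ 2 * a 0,
    a 3 + 3 * t * a 2 + 3 * t ^ 2 * a 1 + t ^ 3 * a 0,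
    a 4 + 4 * t * a 3 + 6 * t ^ 2 * a 2 + 4 * t ^ 3 * a 1 + t ^ 4 * a 0,
    a 5 + 5 * t * a 4 + 10 * t ^ 2 * a 3 + 10 * t ^ 3 * a 2 + 5 * t ^ 4 * a 1 + t ^ 5 * a 0,
    a 6 + 6 * t * a 5 + 15 * t ^ 2 * a 4 + 20 * t ^ 3 * a 3 + 15 * t ^ 4 * a 2 + 6 * t ^ 5 * a 1 + t ^ 6 * a 0,
    a 7 + 7 * t * a 6 + 21 * t ^ 2 * a 5 + 35 * t ^ 3 * a 4 + 35 * t ^ 4 * a 3 + 21 * t ^ 5 * a 2 + 7 * t ^ 6 * a 1 + t ^ 7 * a 0,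
    a 8 + 8 * t * a 7 + 28 * t ^ 2 * a 6 + 56 * t ^ 3 * a 5 + 70 * t ^ 4 * a 4 + 56 * t ^ 5 * a 3 + 28 * t ^ 6 * a 2 + 8 * t ^ 7 * a 1 + t ^ 8 * a 0]

/-- The normalized coefficients of `q(x + t y, y)` for a quartic `q`. -/
def shiftQuartic {R : Type*} [CommRing R] (t : R) (u : Fin 5 → R) : Fin 5 → R :=
  ![u 0,
    u 1 + t * u 0,
    u 2 + 2 * t * u 1 + t ^ 2 * u 0,
    u 3 + 3 * t * u 2 + 3 * t ^ 2 * u 1 + t ^ 3 * u 0,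
    u 4 + 4 * t * u 3 + 6 * t ^ 2 * u 2 + 4 * t ^ 3 * u 1 + t ^ 4 * u 0]

/-- Reversal of the coefficient vector of a quartic. -/
def revQuartic {R : Type*} (u : Fin 5 → R) : Fin 5 → R := fun i => u i.rev

section Equivariance

variable {R S : Type*} [CommRing R] [CommRing S]

theorem map_quarticPairing (φ : R →+* S) (u v : Fin 5 → R) :
    φ (quarticPairing u v) = quarticPairing (φ ∘ u) (φ ∘ v) := by
  simp [quarticPairing, map_ofNat]

theorem map_quarticOp (φ : R →+* S) (a : Fin 9 → R) (u : Fin 5 → R) :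
    φ ∘ quarticOp a u = quarticOp (φ ∘ a) (φ ∘ u) := by
  funext i
  fin_cases i <;> simp [quarticOp, map_ofNat]

theorem map_quarticCov (φ : R →+* S) (a : Fin 9 → R) :
    φ ∘ quarticCov a = quarticCov (φ ∘ a) := by
  funext i
  fin_cases i <;> simp [quarticCov, map_ofNat]

theorem map_quarticHess (φ : R →+* S) (u : Fin 5 → R) :
    φ ∘ quarticHess u = quarticHess (φ ∘ u) := by
  funext i
  fin_cases i <;> simp [quarticHess, map_ofNat]

theorem map_octInv (φ : R →+* S) (a : Fin 9 → R) (d : ℕ) :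
    φ (octInv a d) = octInv (φ ∘ a) d := by
  unfold octInv
  split
  · simp [map_ofNat]
  · simp [cubicInv, map_ofNat]
  all_goals simp only [map_quarticPairing, map_quarticOp, map_quarticCov, map_quarticHess, map_zero]

theorem quarticPairing_shift (t : R) (u v : Fin 5 → R) :
    quarticPairing (shiftQuartic t u) (shiftQuartic t v) = quarticPairing u v := by
  simp [quarticPairing, shiftQuartic]
  ring

theorem quarticOp_shift (t : R) (a : Fin 9 → R) (u : Fin 5 → R) :
    quarticOp (shiftNorm t a) (shiftQuartic t u) = shiftQuartic t (quarticOp a u) := by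
  funext i
  fin_cases i <;> simp [quarticOp, shiftQuartic, shiftNorm] <;> ring

theorem quarticCov_shift (t : R) (a : Fin 9 → R) :
    quarticCov (shiftNorm t a) = shiftQuartic t (quarticCov a) := by
  funext i
  fin_cases i <;> simp [quarticCov, shiftQuartic, shiftNorm] <;> ring

theorem quarticHess_shift (t : R) (u : Fin 5 → R) :
    quarticHess (shiftQuartic t u) = shiftQuartic t (quarticHess u) := by
  funext i
  fin_cases i <;> simp [quarticHess, shiftQuartic] <;> ring

theorem octInv_shift (t : R) (a : Fin 9 → R) (d : ℕ) :
    octInv (shiftNorm t a) d = octInv a d := by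
  unfold octInv
  split
  · simp [shiftNorm]
    ring
  · simp [cubicInv, shiftNorm]
    ring
  all_goals simp only [quarticCov_shift, quarticOp_shift, quarticHess_shift, quarticPairing_shift]

theorem quarticPairing_rev (u v : Fin 5 → R) :
    quarticPairing (revQuartic u) (revQuartic v) = quarticPairing u v := by
  simp [quarticPairing, revQuartic, Fin.rev_eq]
  ring

theorem quarticOp_rev (a : Fin 9 → R) (u : Fin 5 → R) :
    quarticOp (revCoeff a) (revQuartic u) = revQuartic (quarticOp a u) := by
  funext i
  fin_cases i <;> simp [quarticOp, revQuartic, revCoeff, Fin.rev_eq] <;> ring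

theorem quarticCov_rev (a : Fin 9 → R) :
    quarticCov (revCoeff a) = revQuartic (quarticCov a) := by
  funext i
  fin_cases i <;> simp [quarticCov, revQuartic, revCoeff, Fin.rev_eq] <;> ring

theorem quarticHess_rev (u : Fin 5 → R) :
    quarticHess (revQuartic u) = revQuartic (quarticHess u) := by
  funext i
  fin_cases i <;> simp [quarticHess, revQuartic, Fin.rev_eq] <;> ring

theorem octInv_rev (a : Fin 9 → R) (d : ℕ) : octInv (revCoeff a) d = octInv a d := by
  unfold octInv
  split
  · simp [revCoeff, Fin.rev_eq]
    ring
  · simp [cubicInv, revCoeff, Fin.rev_eq]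
    ring
  all_goals simp only [quarticCov_rev, quarticOp_rev, quarticHess_rev, quarticPairing_rev]

theorem octInv_smul (c : R) (a : Fin 9 → R) (d : ℕ) : octInv (c • a) d = c ^ d * octInv a d := by
  have h1 (u v : Fin 5 → R) (b e : R) : quarticPairing (b • u) (e • v) = b * e * quarticPairing u v := by
    simp [quarticPairing]
    ring
  have h2 (u : Fin 5 → R) (b : R) : quarticOp (c • a) (b • u) = (c * b) • quarticOp a u := by
    funext i
    fin_cases i <;> simp [quarticOp] <;> ring
  have h3 : quarticCov (c • a) = c ^ 2 • quarticCov a := by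
    funext i
    fin_cases i <;> simp [quarticCov] <;> ring
  have h4 (u : Fin 5 → R) (b : R) : quarticHess (b • u) = b ^ 2 • quarticHess u := by
    funext i
    fin_cases i <;> simp [quarticHess] <;> ring
  unfold octInv
  split
  · simp
    ring
  · simp [cubicInv]
    ring
  all_goals simp only [h3, h4, h2, h1, mul_zero]
  all_goals ring

end Equivariance

/-- The coefficients of an octavic divided by binomial coefficients. -/
def normCoeff (a : Fin 9 → ℂ) : Fin 9 → ℂ :=
  ![a 0, a 1 / 8, a 2 / 28, a 3 / 56, a 4 / 70, a 5 / 56, a 6 / 28, a 7 / 8, a 8]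

theorem normCoeff_shift (t : ℂ) (a : Fin 9 → ℂ) :
    normCoeff (shiftCoeff t a) = shiftNorm t (normCoeff a) := by
  funext i
  fin_cases i <;> simp [normCoeff, shiftCoeff, shiftNorm] <;> ring

theorem normCoeff_rev (a : Fin 9 → ℂ) : normCoeff (revCoeff a) = revCoeff (normCoeff a) := by
  funext i
  fin_cases i <;> simp [normCoeff, revCoeff, Fin.rev_eq]

/-- The normalized coefficients of the generic octavic. -/
def genericCoeff : Fin 9 → MvPolynomial (Fin 9) ℂ :=
  ![X 0, C (1 / 8) * X 1, C (1 / 28) * X 2, C (1 / 56) * X 3, C (1 / 70) * X 4,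
    C (1 / 56) * X 5, C (1 / 28) * X 6, C (1 / 8) * X 7, X 8]

theorem eval_octInv (a : Fin 9 → ℂ) (d : ℕ) :
    eval a (octInv genericCoeff d) = octInv (normCoeff a) d := by
  rw [map_octInv]
  congr 1
  funext i
  fin_cases i <;> simp [genericCoeff, normCoeff] <;> ring

/-- The basic invariants as elements of the invariant ring. -/
def basicInv (d : ℕ) : invariantRing 8 :=
  ⟨octInv genericCoeff d, by
    rw [mem_invariantRing_iff, raiseD_eq_zero_iff, lowerD_eq_zero_iff]
    constructor
    · intro t a
      rw [eval_octInv, eval_octInv, normCoeff_shift, octInv_shift]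
    · intro t a
      rw [eval_octInv, eval_octInv, normCoeff_rev, octInv_rev, normCoeff_shift, octInv_shift,
        normCoeff_rev, octInv_rev]⟩

theorem eval_basicInv (a : Fin 9 → ℂ) (d : ℕ) :
    eval a (basicInv d : MvPolynomial (Fin 9) ℂ) = octInv (normCoeff a) d :=
  eval_octInv a d

/-- The homomorphism multiplying each variable by an auxiliary indeterminate. -/
def gradeHom : MvPolynomial (Fin 9) ℂ →ₐ[ℂ] Polynomial (MvPolynomial (Fin 9) ℂ) :=
  aeval fun i => Polynomial.X * Polynomial.C (X i)

theorem coeff_gradeHom (p : MvPolynomial (Fin 9) ℂ) (d : ℕ) :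
    (gradeHom p).coeff d = homogeneousComponent d p := by
  induction p using MvPolynomial.induction_on' with
  | monomial m c =>
    have h : gradeHom (monomial m c) =
        Polynomial.monomial m.degree (monomial m c) := by
      rw [gradeHom, aeval_monomial, Finsupp.prod]
      simp only [mul_pow, Finset.prod_mul_distrib]
      rw [Finset.prod_pow_eq_pow_sum, ← Finsupp.degree_apply, ← Polynomial.C_mul_X_pow_eq_monomial,
        monomial_eq, Finsupp.prod, Polynomial.C_mul, map_prod]
      simp only [Polynomial.C_pow]
      rw [← algebraMap_eq, ← Polynomial.algebraMap_apply]
      ring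
    rw [h, Polynomial.coeff_monomial, homogeneousComponent_of_mem (isHomogeneous_monomial _ rfl)]
    simp only [eq_comm]
  | add p q hp hq => rw [map_add, Polynomial.coeff_add, hp, hq, map_add]

theorem basicInv_isHomogeneous (d : ℕ) :
    (basicInv d : MvPolynomial (Fin 9) ℂ).IsHomogeneous d := by
  have h : gradeHom (basicInv d) = Polynomial.X ^ d * Polynomial.C (basicInv d : MvPolynomial (Fin 9) ℂ) := by
    change gradeHom.toRingHom (octInv genericCoeff d) = _ * Polynomial.C (octInv genericCoeff d)
    rw [map_octInv, map_octInv, ← octInv_smul]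
    congr 1
    funext i
    fin_cases i <;> simp [genericCoeff, gradeHom] <;> ring
  have h1 := coeff_gradeHom (basicInv d : MvPolynomial (Fin 9) ℂ) d
  rw [h, Polynomial.coeff_X_pow_mul', if_pos le_rfl, Nat.sub_self, Polynomial.coeff_C_zero] at h1
  rw [h1]
  exact homogeneousComponent_isHomogeneous _ _

/-- The normalized coefficients of `f(x, c y)`. -/
def torusNorm {R : Type*} [CommRing R] (c : R) (a : Fin 9 → R) : Fin 9 → R :=
  fun i => c ^ (i : ℕ) * a i

/-- The coefficients of `c ^ s • q(x, c y)` for a quartic `q`. -/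
def torusQuartic {R : Type*} [CommRing R] (c : R) (s : ℕ) (u : Fin 5 → R) : Fin 5 → R :=
  fun i => c ^ (s + (i : ℕ)) * u i

theorem octInv_torus {R : Type*} [CommRing R] (c : R) (a : Fin 9 → R) (d : ℕ) :
    octInv (torusNorm c a) d = c ^ (4 * d) * octInv a d := by
  have h1 (u v : Fin 5 → R) (s r : ℕ) : quarticPairing (torusQuartic c s u) (torusQuartic c r v) =
      c ^ (s + r + 4) * quarticPairing u v := by
    simp [quarticPairing, torusQuartic]
    ring
  have h2 (u : Fin 5 → R) (s : ℕ) : quarticOp (torusNorm c a) (torusQuartic c s u) =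
      torusQuartic c (s + 4) (quarticOp a u) := by
    funext i
    fin_cases i <;> simp [quarticOp, torusQuartic, torusNorm] <;> ring
  have h3 : quarticCov (torusNorm c a) = torusQuartic c 6 (quarticCov a) := by
    funext i
    fin_cases i <;> simp [quarticCov, torusQuartic, torusNorm] <;> ring
  have h4 (u : Fin 5 → R) (s : ℕ) : quarticHess (torusQuartic c s u) =
      torusQuartic c (2 * s + 2) (quarticHess u) := by
    funext i
    fin_cases i <;> simp [quarticHess, torusQuartic] <;> ring
  unfold octInv
  split
  · simp [torusNorm]
    ring
  · simp [cubicInv, torusNorm]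
    ring
  all_goals simp only [h3, h4, h2, h1, mul_zero]

/-- The value of the polynomial `∑ c * X_{i_1} ⋯ X_{i_k}`, the sum being over the pairs
`(c, [i_1, …, i_k])` of `L`, at `f`. -/
def relVal {R : Type*} [CommRing R] (f : ℕ → R) (L : List (ℤ × List ℕ)) : R :=
  (L.map fun t => (t.1 : R) * (t.2.map f).prod).sum

theorem map_relVal {R S : Type*} [CommRing R] [CommRing S] (φ : R →+* S) (f : ℕ → R)
    (L : List (ℤ × List ℕ)) : φ (relVal f L) = relVal (φ ∘ f) L := by
  simp only [relVal, map_list_sum, List.map_map]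
  congr 2
  funext t
  simp [map_list_prod]

theorem relVal_pow_mul {R : Type*} [CommRing R] (f : ℕ → R) (c : R) (d : ℕ) (L : List (ℤ × List ℕ))
    (hL : ∀ t ∈ L, t.2.sum = d) : relVal (fun i => c ^ i * f i) L = c ^ d * relVal f L := by
  have h (l : List ℕ) : (l.map fun i => c ^ i * f i).prod = c ^ l.sum * (l.map f).prod := by
    induction l with
    | nil => simp
    | cons i l ih => simp [ih]; ring
  rw [relVal, relVal, ← List.sum_map_mul_left]
  congr 1
  refine List.map_congr_left fun t ht => ?_
  rw [h, hL t ht]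
  ring

/-- The normal form of an octavic with `a 0 = a 2 = 0`, `a 1 = 1` and vanishing quadratic invariant. -/
def sliceCoeff {R : Type*} [CommRing R] (x y z w v : R) : Fin 9 → R :=
  ![0, 1, 0, x, 4 * y, z, w, 70 * y ^ 2 - 7 * x * z, v]

theorem map_sliceCoeff {R S : Type*} [CommRing R] [CommRing S] (φ : R →+* S) (x y z w v : R) :
    φ ∘ sliceCoeff x y z w v = sliceCoeff (φ x) (φ y) (φ z) (φ w) (φ v) := by
  funext i
  fin_cases i <;> simp [sliceCoeff, map_ofNat]

/-- The basic invariants of the generic octavic in normal form. -/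
def genericSliceInv : ℕ → MvPolynomial (Fin 5) ℤ :=
  octInv (sliceCoeff (X 0) (X 1) (X 2) (X 3) (X 4))

/-- The weights of the parameters of the normal form. -/
def sliceWeight : Fin 5 → ℕ := ![2, 3, 4, 5, 7]

/-- The homomorphism scaling each parameter by a power of an indeterminate. -/
def sliceHom : MvPolynomial (Fin 5) ℤ →ₐ[ℤ] Polynomial (MvPolynomial (Fin 5) ℤ) :=
  aeval fun i => Polynomial.X ^ sliceWeight i * Polynomial.C (X i)

theorem sliceHom_genericSliceInv (d : ℕ) : sliceHom (genericSliceInv d) =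
    Polynomial.X ^ (3 * d) * Polynomial.C (genericSliceInv d) := by
  have h : Polynomial.X ^ d * sliceHom (genericSliceInv d) =
      Polynomial.X ^ d * (Polynomial.X ^ (3 * d) * Polynomial.C (genericSliceInv d)) := by
    change Polynomial.X ^ d * sliceHom.toRingHom (octInv _ d) =
      Polynomial.X ^ d * (_ * Polynomial.C (octInv _ d))
    rw [map_octInv, map_octInv, ← mul_assoc, ← pow_add, ← octInv_smul,
      show d + 3 * d = 4 * d by ring, ← octInv_torus, map_sliceCoeff, map_sliceCoeff]
    congr 1
    funext i
    fin_cases i <;> simp [sliceHom, sliceCoeff, torusNorm, sliceWeight] <;> ring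
  exact mul_left_cancel₀ (pow_ne_zero _ Polynomial.X_ne_zero) h

theorem coeff_sliceHom (p : MvPolynomial (Fin 5) ℤ) (m : Fin 5 →₀ ℕ) (d : ℕ) :
    coeff m ((sliceHom p).coeff d) = if Finsupp.weight sliceWeight m = d then coeff m p else 0 := by
  induction p using MvPolynomial.induction_on' with
  | monomial k c =>
    have h : sliceHom (monomial k c) =
        Polynomial.monomial (Finsupp.weight sliceWeight k) (monomial k c) := by
      rw [sliceHom, aeval_monomial, Finsupp.prod, Finsupp.weight_apply, Finsupp.sum]
      simp only [mul_pow, Finset.prod_mul_distrib, ← pow_mul]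
      rw [Finset.prod_pow_eq_pow_sum, ← Polynomial.C_mul_X_pow_eq_monomial,
        monomial_eq, Finsupp.prod, Polynomial.C_mul, map_prod]
      simp only [Polynomial.C_pow, smul_eq_mul, mul_comm (sliceWeight _)]
      rw [← algebraMap_eq, ← Polynomial.algebraMap_apply]
      ring
    rw [h, Polynomial.coeff_monomial]
    by_cases hk : k = m
    · subst hk
      split_ifs <;> simp
    · split_ifs <;> simp [coeff_monomial, hk]
  | add p q hp hq =>
    rw [map_add, Polynomial.coeff_add, coeff_add, hp, hq, coeff_add]
    split_ifs <;> simp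

theorem weight_eq_of_relVal_coeff_ne_zero (L : List (ℤ × List ℕ)) (d : ℕ) (hL : ∀ t ∈ L, t.2.sum = d)
    (m : Fin 5 →₀ ℕ) (hm : coeff m (relVal genericSliceInv L) ≠ 0) :
    Finsupp.weight sliceWeight m = 3 * d := by
  have h : sliceHom (relVal genericSliceInv L) =
      Polynomial.X ^ (3 * d) * Polynomial.C (relVal genericSliceInv L) := by
    change sliceHom.toRingHom _ = _
    rw [map_relVal, map_relVal, pow_mul, ← relVal_pow_mul _ _ d L hL]
    congr 1
    funext i
    rw [← pow_mul]
    exact sliceHom_genericSliceInv i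
  have h1 := coeff_sliceHom (relVal genericSliceInv L) m (3 * d)
  rw [h, Polynomial.coeff_X_pow_mul', if_pos le_rfl, Nat.sub_self, Polynomial.coeff_C_zero] at h1
  by_contra hne
  rw [if_neg hne] at h1
  exact hm h1

/-- `p` is a difference of two polynomials with nonnegative coefficients whose coefficients have
total sum at most `B`. -/
def CoeffBounded (p : MvPolynomial (Fin 5) ℤ) (B : ℕ) : Prop :=
  ∃ u v : MvPolynomial (Fin 5) ℕ, p = map (Nat.castRingHom ℤ) u - map (Nat.castRingHom ℤ) v ∧
    eval 1 u + eval 1 v ≤ B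

namespace CoeffBounded

variable {p q : MvPolynomial (Fin 5) ℤ} {B D : ℕ}

theorem mono (hp : CoeffBounded p B) (h : B ≤ D) : CoeffBounded p D := by
  obtain ⟨u, v, hp, hB⟩ := hp
  exact ⟨u, v, hp, hB.trans h⟩

theorem add (hp : CoeffBounded p B) (hq : CoeffBounded q D) : CoeffBounded (p + q) (B + D) := by
  obtain ⟨u, v, rfl, hB⟩ := hp
  obtain ⟨u', v', rfl, hD⟩ := hq
  refine ⟨u + u', v + v', ?_, ?_⟩
  · rw [map_add, map_add]
    ring
  · rw [map_add, map_add]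
    omega

theorem neg (hp : CoeffBounded p B) : CoeffBounded (-p) B := by
  obtain ⟨u, v, rfl, hB⟩ := hp
  exact ⟨v, u, (neg_sub _ _), by omega⟩

theorem sub (hp : CoeffBounded p B) (hq : CoeffBounded q D) : CoeffBounded (p - q) (B + D) := by
  rw [sub_eq_add_neg]
  exact hp.add hq.neg

theorem mul (hp : CoeffBounded p B) (hq : CoeffBounded q D) : CoeffBounded (p * q) (B * D) := by
  obtain ⟨u, v, rfl, hB⟩ := hp
  obtain ⟨u', v', rfl, hD⟩ := hq
  refine ⟨u * u' + v * v', u * v' + v * u', ?_, ?_⟩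
  · simp only [map_add, map_mul]
    ring
  · simp only [map_add, map_mul]
    refine le_trans (le_of_eq ?_) (Nat.mul_le_mul hB hD)
    ring

theorem intCast (c : ℤ) : CoeffBounded (c : MvPolynomial (Fin 5) ℤ) c.natAbs := by
  refine ⟨C c.toNat, C (-c).toNat, ?_, ?_⟩
  · rw [map_C, map_C, ← C_sub, ← eq_intCast (C : ℤ →+* MvPolynomial (Fin 5) ℤ)]
    congr 1
    simp
  · rw [eval_C, eval_C]
    omega

theorem ofNat (n : ℕ) [n.AtLeastTwo] :
    CoeffBounded (OfNat.ofNat n : MvPolynomial (Fin 5) ℤ) (OfNat.ofNat n) :=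
  intCast (n : ℤ)

theorem zero (B : ℕ) : CoeffBounded 0 B :=
  ⟨0, 0, by simp, by simp⟩

theorem one : CoeffBounded 1 1 :=
  ⟨1, 0, by simp, by simp⟩

theorem sq (hp : CoeffBounded p B) : CoeffBounded (p ^ 2) (B * B) := by
  rw [pow_two]
  exact hp.mul hp

theorem cube (hp : CoeffBounded p B) : CoeffBounded (p ^ 3) (B * B * B) := by
  rw [pow_succ, pow_two]
  exact (hp.mul hp).mul hp

theorem ofX (i : Fin 5) : CoeffBounded (X i) 1 :=
  ⟨X i, 0, by simp, by simp⟩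

theorem abs_coeff_le (hp : CoeffBounded p B) (m : Fin 5 →₀ ℕ) : |coeff m p| ≤ B := by
  have key (u : MvPolynomial (Fin 5) ℕ) : coeff m u ≤ eval 1 u := by
    by_cases hm : m ∈ u.support
    · rw [eval_eq]
      refine le_trans (le_of_eq ?_) (Finset.single_le_sum (fun _ _ => Nat.zero_le _) hm)
      simp
    · rw [notMem_support_iff.mp hm]
      exact Nat.zero_le _
  obtain ⟨u, v, rfl, hB⟩ := hp
  have h1 := key u
  have h2 := key v
  rw [coeff_sub, coeff_map, coeff_map]
  simp only [eq_natCast]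
  rw [abs_le]
  omega

end CoeffBounded

section Bounds

variable {A U V : ℕ} {a : Fin 9 → MvPolynomial (Fin 5) ℤ} {u v : Fin 5 → MvPolynomial (Fin 5) ℤ}

theorem CoeffBounded.quarticPairing (hu : ∀ i, CoeffBounded (u i) U) (hv : ∀ i, CoeffBounded (v i) V) :
    CoeffBounded (quarticPairing u v) (16 * (U * V)) := by
  unfold _root_.quarticPairing
  refine CoeffBounded.mono (by
    repeat' first | exact hu _ | exact hv _ | exact CoeffBounded.ofNat _ | apply CoeffBounded.sub | apply CoeffBounded.add | apply CoeffBounded.mul) (le_of_eq (by ring))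

theorem CoeffBounded.quarticOp (ha : ∀ i, CoeffBounded (a i) A) (hu : ∀ i, CoeffBounded (u i) U)
    (i : Fin 5) : CoeffBounded (quarticOp a u i) (16 * (A * U)) := by
  fin_cases i <;> simp only [_root_.quarticOp] <;> refine CoeffBounded.mono (by
    repeat' first | exact hu _ | exact ha _ | exact CoeffBounded.ofNat _ | apply CoeffBounded.sub | apply CoeffBounded.add | apply CoeffBounded.mul) (le_of_eq (by ring))

theorem CoeffBounded.quarticCov (ha : ∀ i, CoeffBounded (a i) A)
    (i : Fin 5) : CoeffBounded (quarticCov a i) (192 * (A * A)) := by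
  have := Nat.zero_le (A * A)
  fin_cases i <;> simp only [_root_.quarticCov] <;> refine CoeffBounded.mono (by
    repeat' first | exact ha _ | exact CoeffBounded.ofNat _ | with_reducible apply CoeffBounded.sq | apply CoeffBounded.sub | apply CoeffBounded.add | apply CoeffBounded.mul) (by linarith)

theorem CoeffBounded.quarticHess (hu : ∀ i, CoeffBounded (u i) U)
    (i : Fin 5) : CoeffBounded (quarticHess u i) (24 * (U * U)) := by
  have := Nat.zero_le (U * U)
  fin_cases i <;> simp only [_root_.quarticHess] <;> refine CoeffBounded.mono (by
    repeat' first | exact hu _ | exact CoeffBounded.ofNat _ | with_reducible apply CoeffBounded.sq | apply CoeffBounded.sub | apply CoeffBounded.add | apply CoeffBounded.mul) (by linarith)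

theorem CoeffBounded.cubicInv (ha : ∀ i, CoeffBounded (a i) A) :
    CoeffBounded (cubicInv a) (984 * (A * A * A)) := by
  simp only [_root_.cubicInv]
  refine CoeffBounded.mono (by
    repeat' first | exact ha _ | exact CoeffBounded.ofNat _ | with_reducible apply CoeffBounded.sq | with_reducible apply CoeffBounded.cube | apply CoeffBounded.sub | apply CoeffBounded.add | apply CoeffBounded.mul) (le_of_eq (by ring))

end Bounds

theorem coeffBounded_sliceCoeff (i : Fin 9) :
    CoeffBounded (sliceCoeff (X 0) (X 1) (X 2) (X 3) (X 4) i) 77 := by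
  fin_cases i <;> simp only [sliceCoeff] <;> first
    | exact CoeffBounded.zero _
    | exact CoeffBounded.mono (by
        repeat' first | exact CoeffBounded.ofX _ | exact CoeffBounded.ofNat _ | exact CoeffBounded.one | with_reducible apply CoeffBounded.sq | apply CoeffBounded.sub | apply CoeffBounded.mul) (by norm_num)

/-- Bounds for the coefficients of the basic invariants of the generic octavic in normal form. -/
def sliceInvBound : ℕ → ℕ
  | 3 => 2 ^ 29
  | 4 => 2 ^ 45
  | 5 => 2 ^ 55
  | 6 => 2 ^ 69
  | 7 => 2 ^ 80
  | 8 => 2 ^ 90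
  | 9 => 2 ^ 104
  | 10 => 2 ^ 115
  | _ => 0

theorem coeffBounded_genericSliceInv (d : ℕ) (hd : 3 ≤ d) :
    CoeffBounded (genericSliceInv d) (sliceInvBound d) := by
  have ha := coeffBounded_sliceCoeff
  have hk := CoeffBounded.quarticCov ha
  have hm := CoeffBounded.quarticOp ha hk
  have hn := CoeffBounded.quarticOp ha hm
  have hh := CoeffBounded.quarticHess hk
  have hAh := CoeffBounded.quarticOp ha hh
  have hAAh := CoeffBounded.quarticOp ha hAh
  unfold genericSliceInv octInv
  split
  · omega
  · exact (CoeffBounded.cubicInv ha).mono (by norm_num [sliceInvBound])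
  · exact (CoeffBounded.quarticPairing hk hk).mono (by norm_num [sliceInvBound])
  · exact (CoeffBounded.quarticPairing hk hm).mono (by norm_num [sliceInvBound])
  · exact (CoeffBounded.quarticPairing hk hh).mono (by norm_num [sliceInvBound])
  · exact (CoeffBounded.quarticPairing hm hh).mono (by norm_num [sliceInvBound])
  · exact (CoeffBounded.quarticPairing hn hh).mono (by norm_num [sliceInvBound])
  · exact (CoeffBounded.quarticPairing hAh hh).mono (by norm_num [sliceInvBound])
  · exact (CoeffBounded.quarticPairing hAAh hh).mono (by norm_num [sliceInvBound])
  · exact CoeffBounded.zero _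

theorem coeffBounded_relVal (L : List (ℤ × List ℕ)) (hL : ∀ t ∈ L, ∀ i ∈ t.2, 3 ≤ i) :
    CoeffBounded (relVal genericSliceInv L)
      (L.map fun t => t.1.natAbs * (t.2.map sliceInvBound).prod).sum := by
  have h (l : List ℕ) (hl : ∀ i ∈ l, 3 ≤ i) :
      CoeffBounded (l.map genericSliceInv).prod (l.map sliceInvBound).prod := by
    induction l with
    | nil => exact CoeffBounded.one
    | cons i l ih =>
      rw [List.map_cons, List.map_cons, List.prod_cons, List.prod_cons]
      exact (coeffBounded_genericSliceInv i (hl i (by simp))).mul (ih fun j hj => hl j (by simp [hj]))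
  unfold relVal
  induction L with
  | nil => exact CoeffBounded.zero _
  | cons t L ih =>
    rw [List.map_cons, List.map_cons, List.sum_cons, List.sum_cons]
    exact ((CoeffBounded.intCast _).mul (h _ (hL t (by simp)))).add (ih fun s hs => hL s (by simp [hs]))

theorem eq_zero_of_sum_mul_pow_eq_zero {ι : Type*} (S : Finset ι) (c : ι → ℤ) (κ : ι → ℕ) (N : ℤ)
    (hκ : Set.InjOn κ S) (hc : ∀ i ∈ S, |c i| < N) (h : ∑ i ∈ S, c i * N ^ κ i = 0) :
    ∀ i ∈ S, c i = 0 := by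
  induction hn : S.card generalizing S with
  | zero => simp [Finset.card_eq_zero.mp hn]
  | succ n ih =>
    classical
    have hS : S.Nonempty := Finset.card_pos.mp (by omega)
    obtain ⟨j, hj, hmin⟩ := S.exists_min_image κ hS
    have hN : 0 < N := (abs_nonneg _).trans_lt (hc j hj)
    rw [← Finset.add_sum_erase S _ hj] at h
    have hdvd : N ^ (κ j + 1) ∣ ∑ i ∈ S.erase j, c i * N ^ κ i := by
      refine Finset.dvd_sum fun i hi => Dvd.dvd.mul_left (pow_dvd_pow _ ?_) _
      obtain ⟨hij, hi⟩ := Finset.mem_erase.mp hi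
      have := hmin i hi
      have := hκ.ne hi hj hij
      omega
    have hdvd' : N ^ (κ j + 1) ∣ c j * N ^ κ j := by
      rw [eq_neg_of_add_eq_zero_left h]
      exact hdvd.neg_right
    rw [pow_succ', mul_dvd_mul_iff_right (pow_pos hN _).ne'] at hdvd'
    have hcj : c j = 0 := Int.eq_zero_of_abs_lt_dvd hdvd' (hc j hj)
    rw [hcj, zero_mul, zero_add] at h
    have ih' := ih (S.erase j) (hκ.mono (Finset.coe_subset.mpr (Finset.erase_subset _ _)))
      (fun i hi => hc i (Finset.mem_of_mem_erase hi)) h (by rw [Finset.card_erase_of_mem hj]; omega)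
    intro i hi
    by_cases hij : i = j
    · rw [hij, hcj]
    · exact ih' i (Finset.mem_erase.mpr ⟨hij, hi⟩)

theorem digits_unique {d m₀ m₁ m₂ m₃ m₄ k₀ k₁ k₂ k₃ k₄ : ℕ} (hd : d ≤ 19)
    (hm : 2 * m₀ + 3 * m₁ + 4 * m₂ + 5 * m₃ + 7 * m₄ = 3 * d)
    (hk : 2 * k₀ + 3 * k₁ + 4 * k₂ + 5 * k₃ + 7 * k₄ = 3 * d)
    (h : 1620 * m₁ + 108 * m₂ + 9 * m₃ + m₄ = 1620 * k₁ + 108 * k₂ + 9 * k₃ + k₄) :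
    m₀ = k₀ ∧ m₁ = k₁ ∧ m₂ = k₂ ∧ m₃ = k₃ ∧ m₄ = k₄ := by
  have key {n x y r s : ℕ} (hr : r < n) (hs : s < n) (hxy : n * x + r = n * y + s) :
      x = y ∧ r = s := by
    have h1 := congrArg (· % n) hxy
    simp only [Nat.mul_add_mod, Nat.mod_eq_of_lt hr, Nat.mod_eq_of_lt hs] at h1
    subst h1
    exact ⟨Nat.eq_of_mul_eq_mul_left (by lia) (Nat.add_right_cancel hxy), rfl⟩
  obtain ⟨h1, rfl⟩ := key (n := 9) (x := 180 * m₁ + 12 * m₂ + m₃) (y := 180 * k₁ + 12 * k₂ + k₃)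
    (r := m₄) (s := k₄) (by linarith) (by linarith) (by linarith)
  obtain ⟨h2, rfl⟩ := key (n := 12) (x := 15 * m₁ + m₂) (y := 15 * k₁ + k₂)
    (r := m₃) (s := k₃) (by linarith) (by linarith) (by linarith)
  obtain ⟨rfl, rfl⟩ := key (n := 15) (r := m₂) (s := k₂) (by linarith) (by linarith) h2
  exact ⟨by linarith, rfl, rfl, rfl, rfl⟩

theorem map_relVal_genericSliceInv {T : Type*} [CommRing T] (L : List (ℤ × List ℕ))
    (φ : MvPolynomial (Fin 5) ℤ →+* T) : φ (relVal genericSliceInv L) =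
      relVal (octInv (sliceCoeff (φ (X 0)) (φ (X 1)) (φ (X 2)) (φ (X 3)) (φ (X 4)))) L := by
  rw [map_relVal]
  congr 1
  funext i
  exact (map_octInv φ _ i).trans (by rw [map_sliceCoeff])

/-- The parameters of the octavic at which relations are tested. -/
def testPoint : Fin 5 → ℤ := ![1, 2 ^ (256 * 1620), 2 ^ (256 * 108), 2 ^ (256 * 9), 2 ^ 256]

theorem relVal_slice_eq_zero (L : List (ℤ × List ℕ)) (d : ℕ) (hd : d ≤ 19)
    (hL : ∀ t ∈ L, t.2.sum = d) (hL' : ∀ t ∈ L, ∀ i ∈ t.2, 3 ≤ i)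
    (hB : (L.map fun t => t.1.natAbs * (t.2.map sliceInvBound).prod).sum < 2 ^ 256)
    (h0 : relVal (octInv (sliceCoeff (testPoint 0) (testPoint 1) (testPoint 2) (testPoint 3)
      (testPoint 4))) L = 0)
    {R : Type*} [CommRing R] (x y z w v : R) : relVal (octInv (sliceCoeff x y z w v)) L = 0 := by
  have key : relVal genericSliceInv L = 0 := by
    set Q := relVal genericSliceInv L with hQ
    have h1 : eval testPoint Q = 0 := by
      rw [map_relVal_genericSliceInv]
      simpa only [eval_X] using h0
    let κ : (Fin 5 →₀ ℕ) → ℕ := fun m => 1620 * m 1 + 108 * m 2 + 9 * m 3 + m 4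
    have hpow (m : Fin 5 →₀ ℕ) : ∏ i, testPoint i ^ m i = (2 ^ 256 : ℤ) ^ κ m := by
      have h2 (e : ℕ) : (2 : ℤ) ^ (256 * e) = (2 ^ 256) ^ e := pow_mul _ _ _
      simp only [testPoint, Fin.prod_univ_five, Matrix.cons_val, h2, one_pow, one_mul, κ, ← pow_mul (2 ^ 256 : ℤ), ← pow_add]
    rw [eval_eq'] at h1
    simp only [hpow] at h1
    have hw (m : Fin 5 →₀ ℕ) (hm : m ∈ Q.support) :
        2 * m 0 + 3 * m 1 + 4 * m 2 + 5 * m 3 + 7 * m 4 = 3 * d := by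
      have := weight_eq_of_relVal_coeff_ne_zero L d hL m (mem_support_iff.mp hm)
      rw [← this, Finsupp.weight_apply, Finsupp.sum_fintype _ _ (by simp), Fin.sum_univ_five]
      simp [sliceWeight, mul_comm]
    have h2 := eq_zero_of_sum_mul_pow_eq_zero Q.support (fun m => coeff m Q) κ (2 ^ 256) ?_ ?_ h1
    · ext m
      by_cases hm : m ∈ Q.support
      · exact h2 m hm
      · exact notMem_support_iff.mp hm
    · intro m hm k hk hmk
      have h3 := hw m hm
      have h4 := hw k hk
      obtain ⟨e0, e1, e2, e3, e4⟩ := digits_unique hd h3 h4 hmk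
      ext i
      fin_cases i <;> assumption
    · intro m _
      have := (coeffBounded_relVal L hL').abs_coeff_le m
      exact this.trans_lt (by exact_mod_cast hB)
  have h5 := map_relVal_genericSliceInv L (eval₂Hom (Int.castRingHom R) ![x, y, z, w, v])
  rw [key, map_zero] at h5
  simpa using h5.symm

/-- Coefficients and factors of a relation of degree 16 between the basic invariants of octavics
with vanishing quadratic invariant. -/
def rel16 : List (ℤ × List ℕ) :=
   [(6075, [8, 8]),
    (-135, [7, 9]),
    (480, [6, 10]),
    (-12960, [4, 4, 8]),
    (405, [3, 4, 9]),
    (-4050, [3, 3, 10]),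
    (-1620, [5, 5, 6]),
    (-224, [4, 6, 6]),
    (2430, [4, 5, 7]),
    (5184, [4, 4, 4, 4]),
    (-810, [3, 6, 7]),
    (2430, [3, 4, 4, 5]),
    (4320, [3, 3, 4, 6])]

/-- Coefficients and factors of a relation of degree 17 between the basic invariants of octavics
with vanishing quadratic invariant. -/
def rel17 : List (ℤ × List ℕ) :=
   [(270, [8, 9]),
    (-135, [7, 10]),
    (-144, [4, 4, 9]),
    (-810, [3, 6, 8]),
    (-405, [3, 5, 9]),
    (405, [3, 4, 10]),
    (16, [5, 6, 6]),
    (48, [4, 6, 7]),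
    (405, [3, 7, 7]),
    (240, [3, 4, 4, 6]),
    (1080, [3, 3, 5, 6]),
    (-1620, [3, 3, 4, 7]),
    (1620, [3, 3, 3, 4, 4])]

/-- Coefficients and factors of a relation of degree 18 between the basic invariants of octavics
with vanishing quadratic invariant. -/
def rel18 : List (ℤ × List ℕ) :=
   [(-972, [9, 9]),
    (21870, [8, 10]),
    (31104, [4, 6, 8]),
    (17496, [4, 5, 9]),
    (-34992, [4, 4, 10]),
    (-65610, [3, 7, 8]),
    (-5508, [3, 6, 9]),
    (32805, [3, 5, 10]),
    (-262440, [3, 3, 4, 8]),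
    (21870, [3, 3, 3, 9]),
    (400, [6, 6, 6]),
    (-11664, [5, 6, 7]),
    (-7776, [4, 4, 4, 6]),
    (-52488, [3, 4, 5, 6]),
    (104976, [3, 4, 4, 7]),
    (297, [3, 3, 6, 6]),
    (65610, [3, 3, 4, 4, 4]),
    (116640, [3, 3, 3, 3, 6])]

/-- Coefficients and factors of a relation of degree 19 between the basic invariants of octavics
with vanishing quadratic invariant. -/
def rel19 : List (ℤ × List ℕ) :=
   [(1080, [9, 10]),
    (18225, [3, 8, 8]),
    (-810, [5, 6, 8]),
    (-3645, [5, 5, 9]),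
    (-12150, [4, 7, 8]),
    (-504, [4, 6, 9]),
    (405, [3, 7, 9]),
    (-1800, [3, 6, 10]),
    (-1215, [3, 3, 4, 9]),
    (-12150, [3, 3, 3, 10]),
    (-125, [6, 6, 7]),
    (3645, [5, 7, 7]),
    (1296, [4, 4, 5, 6]),
    (6318, [4, 4, 4, 7]),
    (4860, [3, 5, 5, 6]),
    (1215, [3, 4, 6, 6]),
    (-7290, [3, 4, 5, 7]),
    (-7290, [3, 4, 4, 4, 4]),
    (1890, [3, 3, 6, 7]),
    (21870, [3, 3, 4, 4, 5])]

theorem relVal_slice_rel16 {R : Type*} [CommRing R] (x y z w v : R) :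
    relVal (octInv (sliceCoeff x y z w v)) rel16 = 0 :=
  relVal_slice_eq_zero _ 16 (by norm_num) (by decide) (by decide) (by decide +kernel) (by decide +kernel) x y z w v

theorem relVal_slice_rel17 {R : Type*} [CommRing R] (x y z w v : R) :
    relVal (octInv (sliceCoeff x y z w v)) rel17 = 0 :=
  relVal_slice_eq_zero _ 17 (by norm_num) (by decide) (by decide) (by decide +kernel) (by decide +kernel) x y z w v

theorem relVal_slice_rel18 {R : Type*} [CommRing R] (x y z w v : R) :
    relVal (octInv (sliceCoeff x y z w v)) rel18 = 0 :=
  relVal_slice_eq_zero _ 18 (by norm_num) (by decide) (by decide) (by decide +kernel) (by decide +kernel) x y z w v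

theorem relVal_slice_rel19 {R : Type*} [CommRing R] (x y z w v : R) :
    relVal (octInv (sliceCoeff x y z w v)) rel19 = 0 :=
  relVal_slice_eq_zero _ 19 (by norm_num) (by decide) (by decide) (by decide +kernel) (by decide +kernel) x y z w v

theorem exists_sum_mul_pow_eq_zero {n : ℕ} (c : ℕ → ℂ) (hn : 0 < n) (h0 : c n ≠ 0) :
    ∃ t : ℂ, ∑ i ∈ Finset.range (n + 1), c i * t ^ i = 0 := by
  let p : Polynomial ℂ := ∑ i ∈ Finset.range (n + 1), Polynomial.C (c i) * Polynomial.X ^ i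
  have hp : p.coeff n = c n := by
    simp [p, Polynomial.coeff_C_mul, Polynomial.coeff_X_pow]
  have hd : p.degree ≠ 0 := by
    intro h
    have h1 := Polynomial.le_degree_of_ne_zero (hp.trans_ne h0)
    rw [h] at h1
    have : (n : WithBot ℕ) ≤ (0 : ℕ) := h1
    exact hn.ne' (Nat.le_zero.mp (by exact_mod_cast this))
  obtain ⟨t, ht⟩ := IsAlgClosed.exists_root p hd
  refine ⟨t, ?_⟩
  simpa [p, Polynomial.IsRoot, Polynomial.eval_finsetSum] using ht

theorem exists_octInv_eq_apply_zero_eq_zero (a : Fin 9 → ℂ) :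
    ∃ b : Fin 9 → ℂ, octInv b = octInv a ∧ b 0 = 0 := by
  by_cases h : a 0 = 0
  · exact ⟨a, rfl, h⟩
  · obtain ⟨t, ht⟩ := exists_sum_mul_pow_eq_zero (n := 8)
      (fun i => (Nat.choose 8 i : ℂ) * a (Fin.rev (Fin.ofNat 9 i))) (by norm_num) (by simpa using h)
    refine ⟨revCoeff (shiftNorm t a), ?_, ?_⟩
    · funext d
      rw [octInv_rev, octInv_shift]
    · rw [← ht]
      simp [revCoeff, shiftNorm, Finset.sum_range_succ, Fin.rev_eq, Nat.choose]
      ring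

theorem relVal_eq_zero_of_forall_ne_zero (b : Fin 9 → Polynomial ℂ) (L : List (ℤ × List ℕ))
    (h : ∀ t : ℂ, t ≠ 0 → relVal (octInv fun i => (b i).eval t) L = 0) :
    relVal (octInv fun i => (b i).eval 0) L = 0 := by
  have h1 (t : ℂ) : (relVal (octInv b) L).eval t = relVal (octInv fun i => (b i).eval t) L := by
    rw [← Polynomial.coe_evalRingHom, map_relVal]
    congr 1
    funext d
    exact map_octInv _ _ _
  have h2 : relVal (octInv b) L = 0 := by
    refine Polynomial.eq_zero_of_infinite_isRoot _ (Set.Infinite.mono (s := {0}ᶜ) ?_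
      (Set.finite_singleton (0 : ℂ)).infinite_compl)
    intro t ht
    exact (h1 t).trans (h t ht)
  rw [← h1, h2, Polynomial.eval_zero]

section Strata

variable {L : List (ℤ × List ℕ)} {d : ℕ} {a : Fin 9 → ℂ}

theorem relVal_eq_zero_of_apply_one_ne_zero (hL : ∀ t ∈ L, t.2.sum = d)
    (hs : ∀ x y z w v : ℂ, relVal (octInv (sliceCoeff x y z w v)) L = 0)
    (ha : octInv a 2 = 0) (h0 : a 0 = 0) (h1 : a 1 ≠ 0) : relVal (octInv a) L = 0 := by
  let b := shiftNorm (-(a 2) / (2 * a 1)) a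
  have hb : octInv b = octInv a := funext fun d => octInv_shift _ _ _
  have hb0 : b 0 = 0 := by simp [b, shiftNorm, h0]
  have hb1 : b 1 = a 1 := by simp [b, shiftNorm, h0]
  have hb2 : b 2 = 0 := by
    simp [b, shiftNorm, h0]
    field_simp
    ring
  have hb7 : octInv b 2 = 0 := by rw [hb, ha]
  rw [← hb]
  rw [← hb1] at h1
  clear_value b
  let c := (b 1)⁻¹ • b
  have hc : c = sliceCoeff (c 3) (c 4 / 4) (c 5) (c 6) (c 8) := by
    have h7 : c 7 = 70 * (c 4 / 4) ^ 2 - 7 * c 3 * c 5 := by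
      simp [octInv, hb0, hb2] at hb7
      simp [c]
      field_simp
      linear_combination (-2) * hb7
    funext i
    fin_cases i <;> simp [sliceCoeff] <;> simp [c, hb0, hb2, h1]
    · field_simp
    · simpa [c] using h7
  have h := hs (c 3) (c 4 / 4) (c 5) (c 6) (c 8)
  rw [← hc, show octInv c = fun i => (b 1)⁻¹ ^ i * octInv b i from funext fun i => octInv_smul _ _ _,
    relVal_pow_mul _ _ d _ hL] at h
  exact (mul_eq_zero.mp h).resolve_left (pow_ne_zero _ (inv_ne_zero h1))

theorem relVal_eq_zero_of_octInv_two_eq_zero (hd : 0 < d) (hL : ∀ t ∈ L, t.2.sum = d)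
    (hs : ∀ x y z w v : ℂ, relVal (octInv (sliceCoeff x y z w v)) L = 0)
    (ha : octInv a 2 = 0) : relVal (octInv a) L = 0 := by
  obtain ⟨b, hb, h0⟩ := exists_octInv_eq_apply_zero_eq_zero a
  rw [← hb] at ha ⊢
  clear hb
  by_cases h1 : b 1 = 0
  swap
  · exact relVal_eq_zero_of_apply_one_ne_zero hL hs ha h0 h1
  have ha' := ha
  simp only [octInv, h0, h1] at ha'
  by_cases h2 : b 2 = 0
  swap
  · let e : Fin 9 → Polynomial ℂ := ![0, Polynomial.X, Polynomial.C (b 2), Polynomial.C (b 3),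
      Polynomial.C (b 4), Polynomial.C (b 5),
      Polynomial.C (b 6) + Polynomial.C (2 * b 7 / (7 * b 2)) * Polynomial.X,
      Polynomial.C (b 7), Polynomial.C (b 8)]
    have he : b = fun i => (e i).eval 0 := by
      funext i
      fin_cases i <;> simp [e, h0, h1]
    rw [he]
    refine relVal_eq_zero_of_forall_ne_zero e L fun t ht =>
      relVal_eq_zero_of_apply_one_ne_zero hL hs ?_ (by simp [e]) (by simpa [e] using ht)
    simp [octInv, e]
    field_simp
    linear_combination 7 * ha'
  by_cases h3 : b 3 = 0
  swap
  · let e : Fin 9 → Polynomial ℂ := ![0, Polynomial.X, Polynomial.C (b 2), Polynomial.C (b 3),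
      Polynomial.C (b 4), Polynomial.C (b 5) - Polynomial.C (b 7 / (7 * b 3)) * Polynomial.X,
      Polynomial.C (b 6), Polynomial.C (b 7), Polynomial.C (b 8)]
    have he : b = fun i => (e i).eval 0 := by
      funext i
      fin_cases i <;> simp [e, h0, h1]
    rw [he]
    refine relVal_eq_zero_of_forall_ne_zero e L fun t ht =>
      relVal_eq_zero_of_apply_one_ne_zero hL hs ?_ (by simp [e]) (by simpa [e] using ht)
    simp [octInv, e, h2]
    field_simp
    simp only [h2] at ha'
    linear_combination 7 * ha'
  have h4 : b 4 = 0 := by simpa [h2, h3] using ha'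
  have h5 : octInv b = fun i => (0 : ℂ) ^ i * octInv b i := by
    funext i
    unfold octInv
    split <;> simp [quarticPairing, quarticOp, quarticHess, quarticCov, cubicInv, h0, h1, h2, h3, h4]
  rw [h5, relVal_pow_mul _ _ d _ hL, zero_pow hd.ne', zero_mul]

end Strata

theorem relVal_rel16 {a : Fin 9 → ℂ} (ha : octInv a 2 = 0) : relVal (octInv a) rel16 = 0 :=
  relVal_eq_zero_of_octInv_two_eq_zero (d := 16) (by norm_num) (by decide) relVal_slice_rel16 ha

theorem relVal_rel17 {a : Fin 9 → ℂ} (ha : octInv a 2 = 0) : relVal (octInv a) rel17 = 0 :=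
  relVal_eq_zero_of_octInv_two_eq_zero (d := 17) (by norm_num) (by decide) relVal_slice_rel17 ha

theorem relVal_rel18 {a : Fin 9 → ℂ} (ha : octInv a 2 = 0) : relVal (octInv a) rel18 = 0 :=
  relVal_eq_zero_of_octInv_two_eq_zero (d := 18) (by norm_num) (by decide) relVal_slice_rel18 ha

theorem relVal_rel19 {a : Fin 9 → ℂ} (ha : octInv a 2 = 0) : relVal (octInv a) rel19 = 0 :=
  relVal_eq_zero_of_octInv_two_eq_zero (d := 19) (by norm_num) (by decide) relVal_slice_rel19 ha

theorem trace_pow_eq_zero {n : ℕ} (M : Matrix (Fin n) (Fin n) ℂ)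
    (h : ∀ k, 0 < k → k ≤ n → (M ^ k).trace = 0) (k : ℕ) (hk : 0 < k) : (M ^ k).trace = 0 := by
  induction k using Nat.strong_induction_on with
  | _ k ih =>
    by_cases hkn : k ≤ n
    · exact h k hk hkn
    · have h1 := M.aeval_self_charpoly
      rw [M.charpoly_monic.as_sum, M.charpoly_natDegree_eq_dim, Fintype.card_fin] at h1
      simp only [map_add, map_pow, Polynomial.aeval_X, map_sum, map_mul, Polynomial.aeval_C] at h1
      have h2 : M ^ k = -∑ i ∈ Finset.range n, M.charpoly.coeff i • M ^ (k - n + i) := by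
        rw [← Nat.sub_add_cancel (le_of_not_ge hkn), pow_add, eq_neg_of_add_eq_zero_left h1,
          mul_neg, Finset.mul_sum]
        simp only [Algebra.algebraMap_eq_smul_one, smul_mul_assoc, one_mul, mul_smul_comm, ← pow_add,
          Nat.add_sub_cancel]
      rw [h2, Matrix.trace_neg, Matrix.trace_sum, Finset.sum_eq_zero, neg_zero]
      intro i hi
      have := Finset.mem_range.mp hi
      rw [Matrix.trace_smul, ih _ (by omega) (by omega), smul_zero]

theorem isNilpotent_of_trace_pow_eq_zero {n : ℕ} (M : Matrix (Fin n) (Fin n) ℂ)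
    (h : ∀ k, 0 < k → k ≤ n → (M ^ k).trace = 0) : IsNilpotent M := by
  have htr (v : Polynomial ℂ) : (Polynomial.aeval M (v * Polynomial.X)).trace = 0 := by
    induction v using Polynomial.induction_on' with
    | add p q hp hq => rw [add_mul, map_add, Matrix.trace_add, hp, hq, add_zero]
    | monomial k c =>
      rw [map_mul, Polynomial.aeval_monomial, Polynomial.aeval_X, mul_assoc, ← pow_succ,
        Algebra.algebraMap_eq_smul_one, smul_mul_assoc, one_mul, Matrix.trace_smul,
        trace_pow_eq_zero M h _ k.succ_pos, smul_zero]
  obtain ⟨q, hq, hX⟩ := M.charpoly.exists_eq_pow_rootMultiplicity_mul_and_not_dvd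
    M.charpoly_monic.ne_zero 0
  set r := M.charpoly.rootMultiplicity 0
  rw [Polynomial.C_0, sub_zero] at hq hX
  obtain ⟨u, w, huw⟩ : IsCoprime ((Polynomial.X : Polynomial ℂ) ^ (r + 1)) q :=
    ((Polynomial.irreducible_X.coprime_iff_not_dvd).mpr hX).pow_left
  have hP := M.aeval_self_charpoly
  rw [hq] at hP
  let E := Polynomial.aeval M (u * Polynomial.X ^ (r + 1))
  have hE : E + Polynomial.aeval M (w * q) = 1 := by
    rw [← map_add, huw, map_one]
  have hE0 : E * Polynomial.aeval M (w * q) = 0 := by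
    rw [← map_mul, show u * Polynomial.X ^ (r + 1) * (w * q) =
      u * Polynomial.X * w * (Polynomial.X ^ r * q) by ring, map_mul, hP, mul_zero]
  have hEE : IsIdempotentElem E := by
    have : E * (E + _) = E * 1 := congrArg (E * ·) hE
    rwa [mul_add, hE0, add_zero, mul_one] at this
  have hEt : E.trace = 0 := by
    simp only [E, pow_succ, ← mul_assoc]
    exact htr _
  have hEz : E = 0 := by
    have h1 : IsIdempotentElem (Matrix.toLinAlgEquiv' E) := hEE.map _
    have h2 := LinearMap.IsIdempotentElem.eq_zero_of_trace_eq_zero h1 (by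
      rw [← hEt]
      exact Matrix.trace_toLin'_eq E)
    simpa using h2
  rw [hEz, zero_add] at hE
  refine ⟨r, ?_⟩
  have : Polynomial.aeval M (Polynomial.X ^ r * q * w) = 0 := by rw [map_mul, hP, zero_mul]
  rwa [mul_assoc, mul_comm q, map_mul, hE, mul_one, map_pow, Polynomial.aeval_X] at this

/-- The matrix of `quarticOp a`. -/
def quarticMatrix (a : Fin 9 → ℂ) : Matrix (Fin 5) (Fin 5) ℂ :=
  !![a 4, -(4 * a 3), 6 * a 2, -(4 * a 1), a 0;
    a 5, -(4 * a 4), 6 * a 3, -(4 * a 2), a 1;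
    a 6, -(4 * a 5), 6 * a 4, -(4 * a 3), a 2;
    a 7, -(4 * a 6), 6 * a 5, -(4 * a 4), a 3;
    a 8, -(4 * a 7), 6 * a 6, -(4 * a 5), a 4]

open Matrix in
theorem quarticMatrix_mulVec (a : Fin 9 → ℂ) (u : Fin 5 → ℂ) :
    quarticMatrix a *ᵥ u = quarticOp a u := by
  funext i
  fin_cases i <;> simp [quarticMatrix, quarticOp, Matrix.mulVec, dotProduct, Fin.sum_univ_five] <;> ring

theorem quarticPairing_quarticOp (a : Fin 9 → ℂ) (u v : Fin 5 → ℂ) :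
    quarticPairing (quarticOp a u) v = quarticPairing u (quarticOp a v) := by
  simp only [quarticPairing, quarticOp, Matrix.cons_val]
  ring

theorem trace_quarticMatrix_pow (a : Fin 9 → ℂ) (h : ∀ d, 2 ≤ d → d ≤ 5 → octInv a d = 0)
    (k : ℕ) (hk : 0 < k) (hk5 : k ≤ 5) : (quarticMatrix a ^ k).trace = 0 := by
  have h2 := h 2 (by norm_num) (by norm_num)
  have h3 := h 3 (by norm_num) (by norm_num)
  have h4 := h 4 (by norm_num) (by norm_num)
  have h5 := h 5 (by norm_num) (by norm_num)
  interval_cases k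
  · simp [quarticMatrix, Matrix.trace, Fin.sum_univ_five]
    ring
  · have : (quarticMatrix a ^ 2).trace = 2 * octInv a 2 := by
      simp [pow_two, quarticMatrix, Matrix.trace, Fin.sum_univ_five, octInv]
      ring
    rw [this, h2, mul_zero]
  · have : (quarticMatrix a ^ 3).trace = octInv a 3 := by
      simp [pow_succ, quarticMatrix, Matrix.trace, Fin.sum_univ_five, octInv, cubicInv]
      ring
    rw [this, h3]
  · have : (quarticMatrix a ^ 4).trace = 8 / 45 * octInv a 4 + 14 / 15 * octInv a 2 ^ 2 := by
      rw [show quarticMatrix a ^ 4 = (quarticMatrix a * quarticMatrix a) * (quarticMatrix a * quarticMatrix a) by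
        simp only [pow_succ, pow_zero, one_mul, mul_assoc]]
      simp [quarticMatrix, Matrix.trace, Fin.sum_univ_five, octInv, quarticPairing, quarticCov]
      ring
    rw [this, h2, h4]
    ring
  · have : (quarticMatrix a ^ 5).trace = 2 / 15 * octInv a 5 + 13 / 15 * octInv a 2 * octInv a 3 := by
      rw [show quarticMatrix a ^ 5 = (quarticMatrix a * quarticMatrix a) * ((quarticMatrix a * quarticMatrix a) * quarticMatrix a) by
        simp only [pow_succ, pow_zero, one_mul, mul_assoc]]
      simp [quarticMatrix, Matrix.trace, Fin.sum_univ_five, octInv, quarticPairing, quarticCov, quarticOp, cubicInv]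
      ring
    rw [this, h2, h5]
    ring

theorem exists_isotropic_kernel (a : Fin 9 → ℂ) (h : ∀ d, 2 ≤ d → d ≤ 5 → octInv a d = 0) :
    ∃ u : Fin 5 → ℂ, u ≠ 0 ∧ quarticOp a u = 0 ∧ quarticPairing u u = 0 := by
  obtain ⟨m, hm⟩ := isNilpotent_of_trace_pow_eq_zero (quarticMatrix a) (trace_quarticMatrix_pow a h)
  have hex : ∃ m, ∀ v : Fin 5 → ℂ, (quarticMatrix a ^ m).mulVec v = 0 :=
    ⟨m, fun v => by rw [hm, Matrix.zero_mulVec]⟩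
  classical
  let n := Nat.find hex
  have hn : ∀ v : Fin 5 → ℂ, (quarticMatrix a ^ n).mulVec v = 0 := Nat.find_spec hex
  have hn0 : n ≠ 0 := by
    intro h0
    have := congrFun (hn 1) 0
    simp [h0] at this
  obtain ⟨v, hv⟩ : ∃ v, (quarticMatrix a ^ (n - 1)).mulVec v ≠ 0 := by
    have := Nat.find_min hex (m := n - 1) (by omega)
    push Not at this
    exact this
  by_cases hn1 : n = 1
  · refine ⟨![0, 0, 0, 0, 1], ?_, ?_, ?_⟩
    · intro h0
      have := congrFun h0 4
      simp at this
    · rw [← quarticMatrix_mulVec, ← hn ![0, 0, 0, 0, 1], hn1, pow_one]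
    · simp [quarticPairing]
  · have hk : quarticOp a ((quarticMatrix a ^ (n - 1)).mulVec v) = 0 := by
      rw [← quarticMatrix_mulVec, Matrix.mulVec_mulVec, ← pow_succ', Nat.sub_add_cancel (by omega), hn]
    refine ⟨_, hv, hk, ?_⟩
    have hu : (quarticMatrix a ^ (n - 1)).mulVec v =
        quarticOp a ((quarticMatrix a ^ (n - 2)).mulVec v) := by
      rw [← quarticMatrix_mulVec, Matrix.mulVec_mulVec, ← pow_succ']
      congr 2
      omega
    nth_rw 1 [hu]
    rw [quarticPairing_quarticOp, hk]
    simp [quarticPairing]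

/-- An octavic, given by its normalized coefficients, is unstable if every invariant of positive
degree vanishes on it. -/
def Unstable (a : Fin 9 → ℂ) : Prop :=
  ∀ h ∈ positiveInvariants, ∀ b, normCoeff b = a → eval b h = 0

theorem Unstable.of_shift {t : ℂ} {a : Fin 9 → ℂ} (h : Unstable (shiftNorm t a)) : Unstable a := by
  intro p hp b hb
  rw [← (raiseD_eq_zero_iff p).mp ((mem_invariantRing_iff p).mp hp.1).1 t b]
  exact h p hp _ (by rw [normCoeff_shift, hb])

theorem revHom_mem_positiveInvariants {p : MvPolynomial (Fin 9) ℂ} (hp : p ∈ positiveInvariants) :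
    revHom p ∈ positiveInvariants := by
  obtain ⟨h1, d, hd, h2⟩ := hp
  have h3 := (mem_invariantRing_iff p).mp h1
  refine ⟨(mem_invariantRing_iff _).mpr ⟨?_, ?_⟩, d, hd, ?_⟩
  · rw [raiseD_revHom, h3.2, map_zero]
  · have h4 := raiseD_revHom (revHom p)
    rw [revHom_revHom, h3.1] at h4
    rw [← revHom_revHom (lowerD _), ← h4, map_zero]
  · exact h2.rename_isHomogeneous

theorem revCoeff_revCoeff {R : Type*} (a : Fin 9 → R) : revCoeff (revCoeff a) = a := by
  funext i
  simp [revCoeff]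

theorem Unstable.of_rev {a : Fin 9 → ℂ} (h : Unstable (revCoeff a)) : Unstable a := by
  intro p hp b hb
  have h1 := h _ (revHom_mem_positiveInvariants hp) (revCoeff b) (by rw [normCoeff_rev, hb])
  rwa [eval_revHom, revCoeff_revCoeff] at h1

theorem Unstable.of_forall_le {a : Fin 9 → ℂ} (h : ∀ i ≤ 4, a i = 0) : Unstable a := by
  intro p hp b hb
  obtain ⟨h1, d, hd, h2⟩ := hp
  have hw := isWeightedHomogeneous_of_weightD_eq_zero (weightD_eq_zero_of_mem h1)
  have hb' : ∀ i ≤ 4, b i = 0 := by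
    intro i hi
    have := congrFun hb i
    rw [h i hi] at this
    revert this hi
    fin_cases i <;> simp [normCoeff]
  rw [eval_eq']
  apply Finset.sum_eq_zero
  intro m hm
  have hm' := mem_support_iff.mp hm
  have h3 := hw hm'
  have h4 := h2 hm'
  obtain ⟨i, hi, hmi⟩ : ∃ i ≤ 4, m i ≠ 0 := by
    by_contra! hc
    rw [Finsupp.weight_apply, Finsupp.sum_fintype _ _ (by simp)] at h3 h4
    have c0 := hc 0 (by decide)
    have c1 := hc 1 (by decide)
    have c2 := hc 2 (by decide)
    have c3 := hc 3 (by decide)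
    have c4 := hc 4 (by decide)
    simp [Fin.sum_univ_succ, coeffWeight] at h3 h4
    omega
  rw [Finset.prod_eq_zero (i := i) (Finset.mem_univ _) (by rw [hb' i hi, zero_pow hmi]), mul_zero]

theorem Unstable.of_forall_ge {a : Fin 9 → ℂ} (h : ∀ i, 4 ≤ i → a i = 0) : Unstable a := by
  apply Unstable.of_rev
  apply Unstable.of_forall_le
  intro i hi
  apply h
  revert hi
  revert i
  decide

theorem unstable_of_kernel_four {a : Fin 9 → ℂ} {u : Fin 5 → ℂ} (hu : quarticOp a u = 0)
    (h0 : u 0 = 0) (h1 : u 1 = 0) (h2 : u 2 = 0) (h3 : u 3 = 0) (h4 : u 4 ≠ 0) : Unstable a := by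
  apply Unstable.of_forall_le
  intro i hi
  have e (j : Fin 5) := congrFun hu j
  have e0 := e 0
  have e1 := e 1
  have e2 := e 2
  have e3 := e 3
  have e4 := e 4
  simp [quarticOp, h0, h1, h2, h3, h4] at e0 e1 e2 e3 e4
  clear e hu
  revert hi
  fin_cases i <;> simp_all

theorem quarticOp_shift_eq_zero {a : Fin 9 → ℂ} {u : Fin 5 → ℂ} (t : ℂ) (hu : quarticOp a u = 0) :
    quarticOp (shiftNorm t a) (shiftQuartic t u) = 0 := by
  rw [quarticOp_shift, hu]
  funext i
  fin_cases i <;> simp [shiftQuartic]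

theorem quarticOp_rev_eq_zero {a : Fin 9 → ℂ} {u : Fin 5 → ℂ} (hu : quarticOp a u = 0) :
    quarticOp (revCoeff a) (revQuartic u) = 0 := by
  rw [quarticOp_rev, hu]
  rfl

theorem unstable_of_kernel_three {a : Fin 9 → ℂ} {u : Fin 5 → ℂ}
    (ha : ∀ d, 2 ≤ d → d ≤ 7 → octInv a d = 0) (hu : quarticOp a u = 0)
    (h0 : u 0 = 0) (h1 : u 1 = 0) (h2 : u 2 = 0) (h3 : u 3 ≠ 0) : Unstable a := by
  apply Unstable.of_shift (t := -u 4 / (4 * u 3))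
  have hb (d : ℕ) (hd : 2 ≤ d) (hd' : d ≤ 7) : octInv (shiftNorm (-u 4 / (4 * u 3)) a) d = 0 := by
    rw [octInv_shift, ha d hd hd']
  have hu' := quarticOp_shift_eq_zero (-u 4 / (4 * u 3)) hu
  have hv : shiftQuartic (-u 4 / (4 * u 3)) u = ![0, 0, 0, u 3, 0] := by
    funext i
    fin_cases i <;> simp [shiftQuartic, h0, h1, h2]
    field_simp
    ring
  rw [hv] at hu'
  generalize shiftNorm (-u 4 / (4 * u 3)) a = b at hb hu' ⊢
  clear ha hu hv
  have e (j : Fin 5) := congrFun hu' j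
  have e0 := e 0
  have e1 := e 1
  have e2 := e 2
  have e3 := e 3
  have e4 := e 4
  simp [quarticOp, h3] at e0 e1 e2 e3 e4
  by_cases hb0 : b 0 = 0
  · apply Unstable.of_forall_le
    intro i hi
    clear e hu' hb
    revert hi
    fin_cases i <;> simp_all
  · have b8 : b 8 = 0 := by
      have := hb 2 (by norm_num) (by norm_num)
      simpa [octInv, e0, e1, e2, e3, e4, hb0] using this
    have b6 : b 6 = 0 := by
      have := hb 3 (by norm_num) (by norm_num)
      simpa [octInv, cubicInv, e0, e1, e2, e3, e4, hb0, b8] using this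
    have b7 : b 7 = 0 := by
      have := hb 7 (by norm_num) (by norm_num)
      simpa [octInv, quarticPairing, quarticOp, quarticCov, quarticHess, e0, e1, e2, e3, e4, hb0, b8, b6]
        using this
    apply Unstable.of_forall_ge
    intro i hi
    clear e hu' hb
    revert hi
    fin_cases i <;> simp_all

theorem eq_zero_or_eq_mul_pow_of_periodic {b : Fin 9 → ℂ}
    (hb : ∀ d, 2 ≤ d → d ≤ 7 → octInv b d = 0) (h3 : b 3 = b 0) (h4 : b 4 = b 1) (h5 : b 5 = b 2)
    (h6 : b 6 = b 0) (h7 : b 7 = b 1) :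
    (∀ i ≤ 4, b i = 0) ∨ ∃ q, ∀ i : Fin 9, b i = b 0 * q ^ (i : ℕ) := by
  have j2 := hb 2 (by norm_num) (by norm_num)
  have j3 := hb 3 (by norm_num) (by norm_num)
  have j6 := hb 6 (by norm_num) (by norm_num)
  simp only [octInv, cubicInv, quarticPairing, quarticCov, quarticHess, Matrix.cons_val,
    h3, h4, h5, h6, h7] at j2 j3 j6
  by_cases h0 : b 0 = 0
  · left
    have b1 : b 1 = 0 := by
      simp only [h0] at j2
      exact pow_eq_zero_iff (two_ne_zero) |>.mp (by linear_combination j2 / 27)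
    have b2 : b 2 = 0 := by
      by_contra hne
      simp only [h0, b1] at j3 j6
      have hs : b 8 = -8 * b 2 := by
        have : b 2 ^ 2 * (b 8 + 8 * b 2) = 0 := by linear_combination j3 / 18
        linear_combination (mul_eq_zero.mp this).resolve_left (pow_ne_zero _ hne)
      simp only [hs] at j6
      have : b 2 ^ 6 = 0 := by linear_combination j6 / 2834352
      exact hne (pow_eq_zero_iff (by norm_num) |>.mp this)
    intro i hi
    revert hi
    fin_cases i <;> simp_all
  · right
    have hs : b 8 = b 2 + 27 * (b 0 * b 2 - b 1 ^ 2) / b 0 := by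
      field_simp
      linear_combination j2
    let q := b 1 / b 0
    let D := b 2 / b 0 - q ^ 2
    have e1 : b 1 = b 0 * q := by simp only [q]; field_simp
    have e2 : b 2 = b 0 * (D + q ^ 2) := by simp only [D]; field_simp; ring
    have e8 : b 8 = b 0 * (28 * D + q ^ 2) := by
      rw [hs, e2, e1]
      field_simp
      ring
    clear_value D q
    simp only [e1, e2, e8] at j3 j6
    have k3 : (q ^ 3 - 1 + 3 * q * D) ^ 2 + 4 * D ^ 3 = 0 := by
      have : b 0 ^ 3 * ((q ^ 3 - 1 + 3 * q * D) ^ 2 + 4 * D ^ 3) = 0 := by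
        linear_combination j3 / 162
      exact (mul_eq_zero.mp this).resolve_left (pow_ne_zero _ h0)
    have k6 : (q ^ 3 - 1 + 3 * q * D) * (q ^ 3 - 1 + q * D) ^ 3 = 0 := by
      have : b 0 ^ 6 * ((q ^ 3 - 1 + 3 * q * D) * (q ^ 3 - 1 + q * D) ^ 3) = 0 := by
        linear_combination j6 / 4782969 + (8 / 27 : ℂ) * b 0 ^ 6 * ((10 * (q ^ 3 - 1) ^ 2
          + 15 * (q * D) * (q ^ 3 - 1) + 9 * (q * D) ^ 2) / 4
          + ((q ^ 3 - 1 + 3 * q * D) ^ 2 + 4 * D ^ 3) / 8 - (q ^ 3 - 1 + 3 * q * D) ^ 2 / 4) * k3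
      exact (mul_eq_zero.mp this).resolve_left (pow_ne_zero _ h0)
    have hD : D = 0 := by
      rcases mul_eq_zero.mp k6 with hv | hv
      · rw [hv] at k3
        exact pow_eq_zero_iff (n := 3) (by norm_num) |>.mp (by linear_combination k3 / 4)
      · replace hv := pow_eq_zero_iff (by norm_num) |>.mp hv
        by_contra hne
        have hq : D = -q ^ 2 := by
          have : D ^ 2 * (D + q ^ 2) = 0 := by
            linear_combination k3 / 4 - (q ^ 3 - 1 + 5 * q * D) * hv / 4
          linear_combination (mul_eq_zero.mp this).resolve_left (pow_ne_zero _ hne)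
        rw [hq] at hv
        exact one_ne_zero (α := ℂ) (by linear_combination -hv)
    subst hD
    have hq : q ^ 3 = 1 := by
      have : (q ^ 3 - 1) ^ 2 = 0 := by linear_combination k3
      linear_combination pow_eq_zero_iff (two_ne_zero) |>.mp this
    refine ⟨q, fun i => ?_⟩
    fin_cases i
    · simp
    · simpa using e1
    · simpa using e2
    · simp [h3, hq]
    · simp only [h4, e1, Fin.reduceFinMk]
      linear_combination (-b 0 * q) * hq
    · simp only [h5, e2, Fin.reduceFinMk]
      linear_combination (-b 0 * q ^ 2) * hq
    · simp only [h6, Fin.reduceFinMk]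
      linear_combination (-b 0 * (q ^ 3 + 1)) * hq
    · simp only [h7, e1, Fin.reduceFinMk]
      linear_combination (-b 0 * q * (q ^ 3 + 1)) * hq
    · simp only [e8, Fin.reduceFinMk]
      linear_combination (-b 0 * q ^ 2 * (q ^ 3 + 1)) * hq

theorem unstable_of_kernel_one {a : Fin 9 → ℂ} {u : Fin 5 → ℂ}
    (ha : ∀ d, 2 ≤ d → d ≤ 7 → octInv a d = 0) (hu : quarticOp a u = 0)
    (huu : quarticPairing u u = 0) (h0 : u 0 = 0) (h1 : u 1 ≠ 0) : Unstable a := by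
  apply Unstable.of_shift (t := -u 2 / (2 * u 1))
  have hb (d : ℕ) (hd : 2 ≤ d) (hd' : d ≤ 7) : octInv (shiftNorm (-u 2 / (2 * u 1)) a) d = 0 := by
    rw [octInv_shift, ha d hd hd']
  have hu' := quarticOp_shift_eq_zero (-u 2 / (2 * u 1)) hu
  have hv : shiftQuartic (-u 2 / (2 * u 1)) u =
      ![0, u 1, 0, 0, shiftQuartic (-u 2 / (2 * u 1)) u 4] := by
    funext i
    fin_cases i <;> simp [shiftQuartic, h0]
    · field_simp
      ring
    · simp only [quarticPairing, h0] at huu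
      field_simp
      linear_combination -huu / 2
  generalize shiftQuartic (-u 2 / (2 * u 1)) u 4 = w at hv
  rw [hv] at hu'
  generalize shiftNorm (-u 2 / (2 * u 1)) a = b at hb hu' ⊢
  clear ha hu hv huu
  have e (j : Fin 5) := congrFun hu' j
  have e0 := e 0
  have e1 := e 1
  have e2 := e 2
  have e3 := e 3
  have e4 := e 4
  simp [quarticOp] at e0 e1 e2 e3 e4
  by_cases hw : w = 0
  · apply Unstable.of_rev
    refine unstable_of_kernel_three (u := revQuartic ![0, u 1, 0, 0, w]) ?_
      (quarticOp_rev_eq_zero hu') ?_ ?_ ?_ ?_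
    · intro d hd hd'
      rw [octInv_rev, hb d hd hd']
    all_goals simp [revQuartic, hw, h1, Fin.rev_eq]
  · obtain ⟨t, ht⟩ := IsAlgClosed.exists_pow_nat_eq (w / (4 * u 1)) (n := 3) (by norm_num)
    have ht0 : t ≠ 0 := by
      rintro rfl
      have : w / (4 * u 1) ≠ 0 := div_ne_zero hw (mul_ne_zero (by norm_num) h1)
      exact this (by rw [← ht]; norm_num)
    have hwt : w = 4 * u 1 * t ^ 3 := by
      rw [ht]
      field_simp
    subst hwt
    let g : Fin 9 → ℂ := fun i => b i / t ^ (i : ℕ)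
    have hg : b = torusNorm t g := by
      funext i
      simp only [torusNorm, g]
      field_simp
    have hper (x y : ℂ) (k : ℕ) (h : x * (4 * u 1 * t ^ 3) - 4 * y * u 1 = 0) :
        y / t ^ (k + 3) = x / t ^ k := by
      have : y = x * t ^ 3 := by
        apply mul_left_cancel₀ (mul_ne_zero (show (4 : ℂ) ≠ 0 by norm_num) h1)
        linear_combination -h
      rw [this]
      field_simp
      ring
    have hgJ (d : ℕ) (hd : 2 ≤ d) (hd' : d ≤ 7) : octInv g d = 0 := by
      have := hb d hd hd'
      rw [hg, octInv_torus] at this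
      exact (mul_eq_zero.mp this).resolve_left (pow_ne_zero _ ht0)
    have g3 : g 3 = g 0 := hper _ _ 0 e0
    have g4 : g 4 = g 1 := hper _ _ 1 e1
    have g5 : g 5 = g 2 := hper _ _ 2 e2
    have g6 : g 6 = g 3 := hper _ _ 3 e3
    have g7 : g 7 = g 4 := hper _ _ 4 e4
    rcases eq_zero_or_eq_mul_pow_of_periodic hgJ g3 g4 g5 (g6.trans g3) (g7.trans g4) with h | ⟨q, hq⟩
    · apply Unstable.of_forall_le
      intro i hi
      rw [hg, torusNorm, h i hi, mul_zero]
    · apply Unstable.of_shift (t := -(t * q))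
      apply Unstable.of_forall_ge
      have hbi (i : Fin 9) : b i = g 0 * (t * q) ^ (i : ℕ) := by
        rw [hg, torusNorm, hq, mul_pow]
        ring
      intro i hi
      revert hi
      fin_cases i <;> simp [shiftNorm, hbi] <;> ring

theorem unstable_of_kernel {a : Fin 9 → ℂ} {u : Fin 5 → ℂ}
    (ha : ∀ d, 2 ≤ d → d ≤ 7 → octInv a d = 0) (hu : quarticOp a u = 0)
    (huu : quarticPairing u u = 0) (hu0 : u ≠ 0) (h0 : u 0 = 0) : Unstable a := by
  by_cases h1 : u 1 = 0
  · have h2 : u 2 = 0 := by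
      simp only [quarticPairing, h0, h1] at huu
      exact pow_eq_zero_iff two_ne_zero |>.mp (by linear_combination huu / 6)
    by_cases h3 : u 3 = 0
    · refine unstable_of_kernel_four hu h0 h1 h2 h3 fun h4 => hu0 ?_
      funext i
      fin_cases i <;> simp_all
    · exact unstable_of_kernel_three ha hu h0 h1 h2 h3
  · exact unstable_of_kernel_one ha hu huu h0 h1

/-- An octavic whose basic invariants of degrees `2, …, 7` all vanish is unstable. -/
theorem unstable_of_octInv_eq_zero {a : Fin 9 → ℂ}
    (ha : ∀ d, 2 ≤ d → d ≤ 7 → octInv a d = 0) : Unstable a := by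
  obtain ⟨u, hu0, hu, huu⟩ := exists_isotropic_kernel a fun d h h' => ha d h (by omega)
  by_cases h0 : u 0 = 0
  · exact unstable_of_kernel ha hu huu hu0 h0
  · obtain ⟨t, ht⟩ := exists_sum_mul_pow_eq_zero (n := 4)
      (fun i => (Nat.choose 4 i : ℂ) * u (Fin.rev (Fin.ofNat 5 i))) (by norm_num) (by simpa using h0)
    have hv : revQuartic (shiftQuartic t u) 0 = 0 := by
      rw [← ht]
      simp [revQuartic, shiftQuartic, Finset.sum_range_succ, Fin.rev_eq, Nat.choose]
      ring
    apply Unstable.of_shift (t := t)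
    apply Unstable.of_rev
    refine unstable_of_kernel ?_ (quarticOp_rev_eq_zero (quarticOp_shift_eq_zero t hu)) ?_ ?_ hv
    · intro d h h'
      rw [octInv_rev, octInv_shift, ha d h h']
    · rw [quarticPairing_rev, quarticPairing_shift, huu]
    · intro h
      apply hu0
      have h' (i : Fin 5) : shiftQuartic t u i = 0 := by
        simpa [revQuartic] using congrFun h i.rev
      have k0 := h' 0
      exact absurd k0 h0

theorem derivation_aeval {ι A : Type*} [Fintype ι] [CommRing A] [Algebra ℂ A]
    (D : Derivation ℂ A A) (f : ι → A) (F : MvPolynomial ι ℂ) :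
    D (aeval f F) = ∑ i, aeval f (pderiv i F) * D (f i) := by
  classical
  induction F using MvPolynomial.induction_on with
  | C c => simp [← algebraMap_eq]
  | add p q hp hq => simp [hp, hq, add_mul, Finset.sum_add_distrib]
  | mul_X p j hp =>
    simp only [map_mul, aeval_X, Derivation.leibniz, hp, pderiv_X, smul_eq_mul, map_add, add_mul,
      Finset.sum_add_distrib, Finset.mul_sum]
    congr 1
    · rw [Finset.sum_eq_single j (fun i _ hi => by simp [Pi.single_eq_of_ne hi.symm]) (by simp)]
      simp
    · exact Finset.sum_congr rfl fun i _ => by ring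

theorem eq_C_of_forall_pderiv_eq_zero {ι : Type*} (F : MvPolynomial ι ℂ)
    (h : ∀ i, pderiv i F = 0) : F = C (coeff 0 F) := by
  classical
  ext m
  rw [coeff_C]
  split_ifs with hm
  · rw [hm]
  · obtain ⟨i, hi⟩ : ∃ i, m i ≠ 0 := by
      by_contra! hc
      exact hm (Finsupp.ext fun i => (hc i).symm)
    have h1 := coeff_pderiv (i := i) F (m - Finsupp.single i 1)
    have h2 : m - Finsupp.single i 1 + Finsupp.single i 1 = m :=
      tsub_add_cancel_of_le (Finsupp.single_le_iff.mpr (Nat.one_le_iff_ne_zero.mpr hi))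
    rw [h i, h2, coeff_zero, eq_comm, mul_eq_zero] at h1
    exact h1.resolve_right (Nat.cast_add_one_ne_zero _)

theorem totalDegree_pderiv_lt {ι : Type*} {F : MvPolynomial ι ℂ} {i : ι} (h : pderiv i F ≠ 0) :
    (pderiv i F).totalDegree < F.totalDegree := by
  classical
  obtain ⟨m, hm, hd⟩ := Finset.exists_mem_eq_sup _ (support_nonempty.mpr h) fun s => s.sum fun _ e => e
  have h1 : coeff (m + Finsupp.single i 1) F ≠ 0 := by
    intro h0
    rw [mem_support_iff, coeff_pderiv, h0, zero_mul] at hm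
    exact hm rfl
  have h2 := le_totalDegree (mem_support_iff.mpr h1)
  rw [Finsupp.sum_add_index' (by simp) (by simp), Finsupp.sum_single_index rfl] at h2
  rw [totalDegree, hd]
  omega

/-- The Jacobian criterion for algebraic independence. -/
theorem algebraicIndependent_of_det_ne_zero {ι A : Type*} [Fintype ι] [DecidableEq ι] [CommRing A]
    [IsDomain A] [Algebra ℂ A] (D : ι → Derivation ℂ A A) (f : ι → A)
    (h : (Matrix.of fun i j => D j (f i)).det ≠ 0) : AlgebraicIndependent ℂ f := by
  rw [algebraicIndependent_iff]
  have key (n : ℕ) : ∀ F : MvPolynomial ι ℂ, F.totalDegree ≤ n → aeval f F = 0 → F = 0 := by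
    induction n using Nat.strong_induction_on with
    | _ n ih =>
      intro F hn hF
      have hv : (fun i => aeval f (pderiv i F)) = 0 := by
        apply Matrix.eq_zero_of_vecMul_eq_zero h
        funext j
        have := derivation_aeval (D j) f F
        rw [hF, map_zero] at this
        exact this.symm
      have hz (i : ι) : pderiv i F = 0 := by
        by_contra hi
        exact hi (ih _ ((totalDegree_pderiv_lt hi).trans_le hn) _ le_rfl (congrFun hv i))
      rw [eq_C_of_forall_pderiv_eq_zero F hz, aeval_C] at hF
      rw [eq_C_of_forall_pderiv_eq_zero F hz,
        (map_eq_zero_iff _ (algebraMap ℂ A).injective).mp hF, C_0]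
  exact fun F hF => key _ F le_rfl hF

/-- The constant vector field on the space of octavics in the direction `v`. -/
def constD (v : Fin 9 → ℂ) : Derivation ℂ (MvPolynomial (Fin 9) ℂ) (MvPolynomial (Fin 9) ℂ) :=
  mkDerivation ℂ fun i => C (v i)

theorem eval_constD (x v : Fin 9 → ℂ) (p : MvPolynomial (Fin 9) ℂ) :
    eval x (constD v p) = (Polynomial.derivative
      (aeval (fun i => Polynomial.C (x i) + Polynomial.C (v i) * Polynomial.X) p)).eval 0 := by
  have h0 (p : MvPolynomial (Fin 9) ℂ) :
      (aeval (fun i => Polynomial.C (x i) + Polynomial.C (v i) * Polynomial.X) p).eval 0 = eval x p := by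
    induction p using MvPolynomial.induction_on with
    | C c => simp
    | add p q hp hq => simp [hp, hq]
    | mul_X p i hp => simp [hp]
  induction p using MvPolynomial.induction_on with
  | C c => simp [constD]
  | add p q hp hq => simp [hp, hq]
  | mul_X p i hp =>
    rw [Derivation.leibniz, map_mul, Polynomial.derivative_mul, map_add, Polynomial.eval_add,
      Polynomial.eval_mul, Polynomial.eval_mul, h0 p, h0 (X i), smul_eq_mul, smul_eq_mul, map_mul, map_mul, hp]
    simp [constD]
    ring

theorem eval_constD_basicInv (x v : Fin 9 → ℂ) (d : ℕ) :
    eval x (constD v (basicInv d : MvPolynomial (Fin 9) ℂ)) = (Polynomial.derivative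
      (octInv (fun i => Polynomial.C (normCoeff x i) + Polynomial.C (normCoeff v i) * Polynomial.X) d)).eval 0 := by
  rw [eval_constD]
  congr 2
  change (aeval (fun i => Polynomial.C (x i) + Polynomial.C (v i) * Polynomial.X)).toRingHom
    (octInv genericCoeff d) = _
  rw [map_octInv]
  congr 1
  funext i
  fin_cases i <;> simp [genericCoeff, normCoeff, div_eq_mul_inv] <;> ring

theorem algebraicIndependent_basicInv :
    AlgebraicIndependent ℂ fun k : Fin 6 => basicInv (k + 2) := by
  rw [← (invariantRing 8).val.algebraicIndependent_iff Subtype.val_injective]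
  let x : Fin 9 → ℂ := ![0, 0, 28, 0, 0, 56, 0, 0, 0]
  let v : Fin 6 → Fin 9 → ℂ := ![![1, 0, 0, 0, 0, 0, 0, 0, 0], ![0, 8, 0, 0, 0, 0, 0, 0, 0],
    ![0, 0, 28, 0, 0, 0, 0, 0, 0], ![0, 0, 0, 56, 0, 0, 0, 0, 0], ![0, 0, 0, 0, 0, 0, 0, 8, 0],
    ![0, 0, 0, 0, 0, 0, 0, 0, 1]]
  refine algebraicIndependent_of_det_ne_zero (fun j => constD (v j)) _ fun h => ?_
  have h1 := congrArg (eval x) h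
  rw [RingHom.map_det, map_zero] at h1
  have hM : (eval x).mapMatrix (Matrix.of fun i j : Fin 6 => constD (v j) (basicInv (i + 2))) =
      !![0, 0, 0, -56, 0, 0;
         0, 0, 144, 0, 0, 18;
         0, 4320, 0, 0, 3240, 0;
         3600, 0, 0, -55584, 0, 0;
         0, 0, 3149280, 0, 0, -157464;
         0, -8087040, 0, 0, 4385664, 0] := by
    ext i j
    rw [RingHom.mapMatrix_apply, Matrix.map_apply, Matrix.of_apply, eval_constD_basicInv]
    fin_cases j <;> fin_cases i <;>
      simp [octInv, cubicInv, quarticPairing, quarticOp, quarticCov, quarticHess, x, v, normCoeff,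
        Polynomial.derivative_pow] <;>
      norm_num
  change ((eval x).mapMatrix (Matrix.of fun i j : Fin 6 => constD (v j) (basicInv (i + 2)))).det = 0 at h1
  rw [hM, ← Matrix.exists_mulVec_eq_zero_iff] at h1
  obtain ⟨w, hw, hw0⟩ := h1
  have e (i : Fin 6) := congrFun hw0 i
  have e0 := e 0
  have e1 := e 1
  have e2 := e 2
  have e3 := e 3
  have e4 := e 4
  have e5 := e 5
  simp [Matrix.mulVec, dotProduct, Fin.sum_univ_succ] at e0 e1 e2 e3 e4 e5
  apply hw
  have w3 : w 3 = 0 := e0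
  have w0 : w 0 = 0 := by simpa [w3] using e3
  have w2 : w 2 = 0 := by
    linear_combination (e1 * 157464 + e4 * 18) / (144 * 157464 + 3149280 * 18)
  have w5 : w 5 = 0 := by simpa [w2] using e1
  have w1 : w 1 = 0 := by
    linear_combination (e2 * 4385664 - e5 * 3240) / (4320 * 4385664 + 8087040 * 3240)
  have w4 : w 4 = 0 := by simpa [w1] using e2
  funext i
  fin_cases i <;> assumption

theorem isHSOP_of_nullcone {d : Fin 6 → ℕ} {p : Fin 6 → invariantRing 8} (hd : ∀ k, 0 < d k)
    (hp : ∀ k, (p k : MvPolynomial (Fin 9) ℂ).IsHomogeneous (d k))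
    (h : ∀ a, (∀ k, eval a (p k : MvPolynomial (Fin 9) ℂ) = 0) →
      ∀ e, 2 ≤ e → e ≤ 7 → octInv (normCoeff a) e = 0) : IsHSOP 8 d p := by
  have hfin : Module.Finite (Algebra.adjoin ℂ (Set.range p)) (invariantRing 8) :=
    finite_of_nullcone p d hd hp fun a ha f hf => unstable_of_octInv_eq_zero (h a ha) f hf a rfl
  refine ⟨hd, hp, ?_, hfin⟩
  have : Algebra.IsIntegral (Algebra.adjoin ℂ (Set.range p)) (invariantRing 8) := inferInstance
  have h6 := algebraicIndependent_basicInv.cardinalMk_le_trdeg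
  have h7 : Cardinal.mk (Fin 6) ≤ Algebra.trdeg ℂ (invariantRing 8) := by simpa using h6
  exact (Algebra.IsAlgebraic.isTranscendenceBasis_of_le_trdeg_of_finite ℂ p h7).1

theorem basicInv_pow_isHomogeneous {d k e : ℕ} (h : d * k = e) :
    ((basicInv d : MvPolynomial (Fin 9) ℂ) ^ k).IsHomogeneous e :=
  h ▸ (basicInv_isHomogeneous d).pow k

/-- If the common zeros of the `p k` in the locus cut out by the four relations are killed by the
basic invariants of degrees two to seven, then the `p k` form a hsop. -/
theorem isHSOP_of_relations {d : Fin 6 → ℕ} {p : Fin 6 → invariantRing 8}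
    (hp : ∀ k, 0 < d k ∧ (p k : MvPolynomial (Fin 9) ℂ).IsHomogeneous (d k))
    (h2 : p 0 = basicInv 2)
    (h : ∀ a (f : ℕ → ℂ), (∀ e, eval a (basicInv e : MvPolynomial (Fin 9) ℂ) = f e) →
      (∀ k, eval a (p k : MvPolynomial (Fin 9) ℂ) = 0) →
      relVal f rel16 = 0 → relVal f rel17 = 0 → relVal f rel18 = 0 → relVal f rel19 = 0 →
      f 3 = 0 ∧ f 4 = 0 ∧ f 5 = 0 ∧ f 6 = 0 ∧ f 7 = 0) : IsHSOP 8 d p := by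
  refine isHSOP_of_nullcone (fun k => (hp k).1) (fun k => (hp k).2) fun a ha => ?_
  have h2 : octInv (normCoeff a) 2 = 0 := by
    rw [← eval_basicInv, ← h2]
    exact ha 0
  obtain ⟨h3, h4, h5, h6, h7⟩ := h a (octInv (normCoeff a)) (eval_basicInv a) ha
    (relVal_rel16 h2) (relVal_rel17 h2) (relVal_rel18 h2) (relVal_rel19 h2)
  intro e he he'
  interval_cases e <;> assumption

theorem exists_isHSOP_2_3_4_5_6_7 :
    ∃ p : Fin 6 → invariantRing 8, IsHSOP 8 ![2, 3, 4, 5, 6, 7] p := by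
  refine ⟨![basicInv 2, basicInv 3, basicInv 4, basicInv 5, basicInv 6, basicInv 7],
    isHSOP_of_relations ?_ rfl fun a f hf h _ _ _ _ => ?_⟩
  · simp [Fin.forall_fin_succ, basicInv_isHomogeneous]
  · simp [Fin.forall_fin_succ, hf] at h
    tauto

theorem exists_isHSOP_2_3_4_5_8_42 :
    ∃ p : Fin 6 → invariantRing 8, IsHSOP 8 ![2, 3, 4, 5, 8, 42] p := by
  refine ⟨![basicInv 2, basicInv 3, basicInv 4, basicInv 5, basicInv 8,
    basicInv 6 ^ 7 + basicInv 7 ^ 6], isHSOP_of_relations ?_ rfl fun a f hf h _ r17 _ r19 => ?_⟩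
  · simp [Fin.forall_fin_succ, basicInv_isHomogeneous, basicInv_pow_isHomogeneous,
      IsHomogeneous.add]
  · simp [Fin.forall_fin_succ, hf] at h
    obtain ⟨h2, h3, h4, h5, h8, h67⟩ := h
    simp [relVal, rel17, rel19, h3, h4, h5, h8] at r17 r19
    have h : f 6 = 0 ∨ f 7 = 0 := by grind
    rcases h with h | h <;> simp_all

theorem exists_isHSOP_2_3_4_5_9_42 :
    ∃ p : Fin 6 → invariantRing 8, IsHSOP 8 ![2, 3, 4, 5, 9, 42] p := by
  refine ⟨![basicInv 2, basicInv 3, basicInv 4, basicInv 5, basicInv 9,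
    basicInv 6 ^ 7 + basicInv 7 ^ 6], isHSOP_of_relations ?_ rfl fun a f hf h _ _ _ r19 => ?_⟩
  · simp [Fin.forall_fin_succ, basicInv_isHomogeneous, basicInv_pow_isHomogeneous,
      IsHomogeneous.add]
  · simp [Fin.forall_fin_succ, hf] at h
    obtain ⟨h2, h3, h4, h5, h9, h67⟩ := h
    simp [relVal, rel19, h3, h4, h5, h9] at r19
    rcases r19 with h | h <;> simp_all

theorem exists_isHSOP_2_3_4_5_10_42 :
    ∃ p : Fin 6 → invariantRing 8, IsHSOP 8 ![2, 3, 4, 5, 10, 42] p := by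
  refine ⟨![basicInv 2, basicInv 3, basicInv 4, basicInv 5, basicInv 10,
    basicInv 6 ^ 7 + basicInv 7 ^ 6], isHSOP_of_relations ?_ rfl fun a f hf h _ _ _ r19 => ?_⟩
  · simp [Fin.forall_fin_succ, basicInv_isHomogeneous, basicInv_pow_isHomogeneous,
      IsHomogeneous.add]
  · simp [Fin.forall_fin_succ, hf] at h
    obtain ⟨h2, h3, h4, h5, h10, h67⟩ := h
    simp [relVal, rel19, h3, h4, h5, h10] at r19
    rcases r19 with h | h <;> simp_all

theorem exists_isHSOP_2_3_4_6_8_35 :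
    ∃ p : Fin 6 → invariantRing 8, IsHSOP 8 ![2, 3, 4, 6, 8, 35] p := by
  refine ⟨![basicInv 2, basicInv 3, basicInv 4, basicInv 6, basicInv 8,
    basicInv 5 ^ 7 + basicInv 7 ^ 5], isHSOP_of_relations ?_ rfl fun a f hf h _ _ r18 r19 => ?_⟩
  · simp [Fin.forall_fin_succ, basicInv_isHomogeneous, basicInv_pow_isHomogeneous,
      IsHomogeneous.add]
  · simp [Fin.forall_fin_succ, hf] at h
    obtain ⟨h2, h3, h4, h6, h8, h57⟩ := h
    simp [relVal, rel18, h3, h4, h6, h8] at r18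
    simp [relVal, rel19, h3, h4, h6, h8, r18] at r19
    rcases r19 with h | h <;> simp_all

theorem exists_isHSOP_2_3_4_6_9_35 :
    ∃ p : Fin 6 → invariantRing 8, IsHSOP 8 ![2, 3, 4, 6, 9, 35] p := by
  refine ⟨![basicInv 2, basicInv 3, basicInv 4, basicInv 6, basicInv 9,
    basicInv 5 ^ 7 + basicInv 7 ^ 5], isHSOP_of_relations ?_ rfl fun a f hf h _ _ _ r19 => ?_⟩
  · simp [Fin.forall_fin_succ, basicInv_isHomogeneous, basicInv_pow_isHomogeneous,
      IsHomogeneous.add]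
  · simp [Fin.forall_fin_succ, hf] at h
    obtain ⟨h2, h3, h4, h6, h9, h57⟩ := h
    simp [relVal, rel19, h3, h4, h6, h9] at r19
    rcases r19 with h | h <;> simp_all

theorem exists_isHSOP_2_3_4_7_8_30 :
    ∃ p : Fin 6 → invariantRing 8, IsHSOP 8 ![2, 3, 4, 7, 8, 30] p := by
  refine ⟨![basicInv 2, basicInv 3, basicInv 4, basicInv 7, basicInv 8,
    basicInv 5 ^ 6 + basicInv 6 ^ 5], isHSOP_of_relations ?_ rfl fun a f hf h _ r17 _ _ => ?_⟩
  · simp [Fin.forall_fin_succ, basicInv_isHomogeneous, basicInv_pow_isHomogeneous,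
      IsHomogeneous.add]
  · simp [Fin.forall_fin_succ, hf] at h
    obtain ⟨h2, h3, h4, h7, h8, h56⟩ := h
    simp [relVal, rel17, h3, h4, h7, h8] at r17
    rcases r17 with h | h <;> simp_all

theorem exists_isHSOP_2_3_4_7_9_30 :
    ∃ p : Fin 6 → invariantRing 8, IsHSOP 8 ![2, 3, 4, 7, 9, 30] p := by
  refine ⟨![basicInv 2, basicInv 3, basicInv 4, basicInv 7, basicInv 9,
    basicInv 5 ^ 6 + basicInv 6 ^ 5], isHSOP_of_relations ?_ rfl fun a f hf h _ r17 _ _ => ?_⟩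
  · simp [Fin.forall_fin_succ, basicInv_isHomogeneous, basicInv_pow_isHomogeneous,
      IsHomogeneous.add]
  · simp [Fin.forall_fin_succ, hf] at h
    obtain ⟨h2, h3, h4, h7, h9, h56⟩ := h
    simp [relVal, rel17, h3, h4, h7, h9] at r17
    rcases r17 with h | h <;> simp_all

theorem exists_isHSOP_2_3_4_8_9_210 :
    ∃ p : Fin 6 → invariantRing 8, IsHSOP 8 ![2, 3, 4, 8, 9, 210] p := by
  refine ⟨![basicInv 2, basicInv 3, basicInv 4, basicInv 8, basicInv 9,
    basicInv 5 ^ 42 + basicInv 6 ^ 35 + basicInv 7 ^ 30],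
    isHSOP_of_relations ?_ rfl fun a f hf h r16 r17 r18 r19 => ?_⟩
  · have h := ((basicInv_pow_isHomogeneous (d := 5) (k := 42) (e := 210) (by norm_num)).add
      (basicInv_pow_isHomogeneous (d := 6) (k := 35) (by norm_num))).add
      (basicInv_pow_isHomogeneous (d := 7) (k := 30) (by norm_num))
    simp [Fin.forall_fin_succ, basicInv_isHomogeneous, h]
  · simp [Fin.forall_fin_succ, hf] at h
    obtain ⟨h2, h3, h4, h8, h9, h567⟩ := h
    simp [relVal, rel16, rel17, rel18, rel19, h3, h4, h8, h9] at r16 r17 r18 r19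
    by_cases h6 : f 6 = 0
    · have h : f 5 = 0 ∨ f 7 = 0 := by simpa [h6] using r19
      rcases h with h | h <;> simp_all
    · have h10 : f 10 = 27 / 8 * f 5 ^ 2 := mul_left_cancel₀ h6 (by linear_combination r16 / 480)
      have h66 : f 6 ^ 2 = 11664 / 400 * (f 5 * f 7) :=
        mul_left_cancel₀ h6 (by linear_combination r18 / 400)
      have h57 : f 5 * (f 5 * f 7) = 0 := by
        rw [h10] at r17
        linear_combination (r17 - 16 * f 5 * h66) / (16 * 11664 / 400 - 135 * 27 / 8)
      grind

theorem mul_eq_zero_of_relations {f : ℕ → ℂ} (h3 : f 3 = 0) (h5 : f 5 = 0) (h6 : f 6 = 0)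
    (h9 : f 9 = 0) (r16 : relVal f rel16 = 0) (r19 : relVal f rel19 = 0) :
    f 4 = 0 ∨ f 7 = 0 := by
  simp [relVal, rel16, rel19, h3, h5, h6, h9] at r16 r19
  by_contra! h
  obtain ⟨h4, h7⟩ := h
  have h8 : f 8 = 13 / 25 * f 4 ^ 2 :=
    mul_left_cancel₀ (mul_ne_zero h4 h7) (by linear_combination -r19 / 12150)
  rw [h8] at r16
  have : f 4 ^ 4 = 0 := by
    linear_combination r16 / (6075 * (13 / 25) ^ 2 - 12960 * 13 / 25 + 5184)
  exact h4 (by simpa using this)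

theorem exists_isHSOP_2_3_5_6_9_28 :
    ∃ p : Fin 6 → invariantRing 8, IsHSOP 8 ![2, 3, 5, 6, 9, 28] p := by
  refine ⟨![basicInv 2, basicInv 3, basicInv 5, basicInv 6, basicInv 9,
    basicInv 4 ^ 7 + basicInv 7 ^ 4], isHSOP_of_relations ?_ rfl fun a f hf h r16 _ _ r19 => ?_⟩
  · simp [Fin.forall_fin_succ, basicInv_isHomogeneous, basicInv_pow_isHomogeneous,
      IsHomogeneous.add]
  · simp [Fin.forall_fin_succ, hf] at h
    obtain ⟨h2, h3, h5, h6, h9, h47⟩ := h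
    rcases mul_eq_zero_of_relations h3 h5 h6 h9 r16 r19 with h | h <;> simp_all

theorem exists_isHSOP_2_3_5_6_10_28 :
    ∃ p : Fin 6 → invariantRing 8, IsHSOP 8 ![2, 3, 5, 6, 10, 28] p := by
  refine ⟨![basicInv 2, basicInv 3, basicInv 5, basicInv 6, basicInv 10,
    basicInv 4 ^ 7 + basicInv 7 ^ 4], isHSOP_of_relations ?_ rfl fun a f hf h r16 _ r18 r19 => ?_⟩
  · simp [Fin.forall_fin_succ, basicInv_isHomogeneous, basicInv_pow_isHomogeneous,
      IsHomogeneous.add]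
  · simp [Fin.forall_fin_succ, hf] at h
    obtain ⟨h2, h3, h5, h6, h10, h47⟩ := h
    simp [relVal, rel18, h3, h5, h6, h10] at r18
    rcases mul_eq_zero_of_relations h3 h5 h6 r18 r16 r19 with h | h <;> simp_all

theorem exists_isHSOP_2_3_5_9_12_14 :
    ∃ p : Fin 6 → invariantRing 8, IsHSOP 8 ![2, 3, 5, 9, 12, 14] p := by
  refine ⟨![basicInv 2, basicInv 3, basicInv 5, basicInv 9, basicInv 4 ^ 3 + basicInv 6 ^ 2,
    basicInv 7 ^ 2 + basicInv 4 ^ 2 * basicInv 6],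
    isHSOP_of_relations ?_ rfl fun a f hf h r16 r17 _ r19 => ?_⟩
  · have h : ((basicInv 4 : MvPolynomial (Fin 9) ℂ) ^ 2 * basicInv 6).IsHomogeneous 14 :=
      (basicInv_pow_isHomogeneous (e := 8) rfl).mul (basicInv_isHomogeneous 6)
    simp [Fin.forall_fin_succ, basicInv_isHomogeneous, basicInv_pow_isHomogeneous,
      IsHomogeneous.add, h]
  · simp [Fin.forall_fin_succ, hf] at h
    obtain ⟨h2, h3, h5, h9, h46, h467⟩ := h
    simp [relVal, rel16, rel17, rel19, h3, h5, h9] at r16 r17 r19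
    have h : f 4 = 0 ∨ f 6 = 0 ∨ f 7 = 0 := by
      by_contra! h
      obtain ⟨h4, h6, h7⟩ := h
      have h10 : f 10 = 16 / 45 * (f 4 * f 6) :=
        mul_left_cancel₀ h7 (by linear_combination -r17 / 135)
      have h8 : f 8 = 6443 / 12150 * f 4 ^ 2 :=
        mul_left_cancel₀ (mul_ne_zero h4 h7)
          (by linear_combination (-r19 - 125 * f 7 * h46) / 12150)
      rw [h8, h10] at r16
      have : f 4 ^ 4 = 0 := by
        linear_combination (r16 - (480 * 16 / 45 - 224) * f 4 * h46) /
          (6075 * (6443 / 12150) ^ 2 - 12960 * 6443 / 12150 + 5184 - (480 * 16 / 45 - 224))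
      exact h4 (by simpa using this)
    have h' : f 4 = 0 ∨ f 6 = 0 := by
      rcases h with h | h | h <;> simp_all
    rcases h' with h | h <;> simp_all

theorem exists_isHSOP_2_4_5_6_8_21 :
    ∃ p : Fin 6 → invariantRing 8, IsHSOP 8 ![2, 4, 5, 6, 8, 21] p := by
  refine ⟨![basicInv 2, basicInv 4, basicInv 5, basicInv 6, basicInv 8,
    basicInv 3 ^ 7 + basicInv 7 ^ 3], isHSOP_of_relations ?_ rfl fun a f hf h r16 r17 r18 _ => ?_⟩
  · simp [Fin.forall_fin_succ, basicInv_isHomogeneous, basicInv_pow_isHomogeneous,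
      IsHomogeneous.add]
  · simp [Fin.forall_fin_succ, hf] at h
    obtain ⟨h2, h4, h5, h6, h8, h37⟩ := h
    simp [relVal, rel16, rel17, rel18, h4, h5, h6, h8] at r16 r17 r18
    have h : f 3 = 0 ∨ f 7 = 0 := by
      by_contra! h
      obtain ⟨h3, h7⟩ := h
      have h10 : f 10 = 3 * (f 3 * f 7) :=
        mul_left_cancel₀ h7 (by linear_combination -r17 / 135)
      have h9 : f 9 = -90 * f 3 ^ 3 :=
        mul_left_cancel₀ h7 (by rw [h10] at r16; linear_combination -r16 / 135)
      rw [h9] at r18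
      have : f 3 ^ 6 = 0 := by
        linear_combination r18 / (-972 * 90 ^ 2 - 21870 * 90)
      exact h3 (by simpa using this)
    rcases h with h | h <;> simp_all

theorem stmt_19 :
    (∃ p : Fin (8-2) → invariantRing 8, IsHSOP 8 ![2, 3, 4, 5, 6, 7] p) ∧
    (∃ p : Fin (8-2) → invariantRing 8, IsHSOP 8 ![2, 3, 4, 5, 8, 42] p) ∧
    (∃ p : Fin (8-2) → invariantRing 8, IsHSOP 8 ![2, 3, 4, 5, 9, 42] p) ∧
    (∃ p : Fin (8-2) → invariantRing 8, IsHSOP 8 ![2, 3, 4, 5, 10, 42] p) ∧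
    (∃ p : Fin (8-2) → invariantRing 8, IsHSOP 8 ![2, 3, 4, 6, 8, 35] p) ∧
    (∃ p : Fin (8-2) → invariantRing 8, IsHSOP 8 ![2, 3, 4, 6, 9, 35] p) ∧
    (∃ p : Fin (8-2) → invariantRing 8, IsHSOP 8 ![2, 3, 4, 7, 8, 30] p) ∧
    (∃ p : Fin (8-2) → invariantRing 8, IsHSOP 8 ![2, 3, 4, 7, 9, 30] p) ∧
    (∃ p : Fin (8-2) → invariantRing 8, IsHSOP 8 ![2, 3, 4, 8, 9, 210] p) ∧
    (∃ p : Fin (8-2) → invariantRing 8, IsHSOP 8 ![2, 3, 5, 6, 9, 28] p) ∧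
    (∃ p : Fin (8-2) → invariantRing 8, IsHSOP 8 ![2, 3, 5, 6, 10, 28] p) ∧
    (∃ p : Fin (8-2) → invariantRing 8, IsHSOP 8 ![2, 3, 5, 9, 12, 14] p) ∧
    (∃ p : Fin (8-2) → invariantRing 8, IsHSOP 8 ![2, 4, 5, 6, 8, 21] p) := by
  exact ⟨exists_isHSOP_2_3_4_5_6_7,
    exists_isHSOP_2_3_4_5_8_42,
    exists_isHSOP_2_3_4_5_9_42,
    exists_isHSOP_2_3_4_5_10_42,
    exists_isHSOP_2_3_4_6_8_35,
    exists_isHSOP_2_3_4_6_9_35,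
    exists_isHSOP_2_3_4_7_8_30,
    exists_isHSOP_2_3_4_7_9_30,
    exists_isHSOP_2_3_4_8_9_210,
    exists_isHSOP_2_3_5_6_9_28,
    exists_isHSOP_2_3_5_6_10_28,
    exists_isHSOP_2_3_5_9_12_14,
    exists_isHSOP_2_4_5_6_8_21⟩
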